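/- arXiv:2210.11462 — 9 statements merged into one kernel-verified Lean document; each statement's English description precedes it below -/
import Mathlib

section
/- Let f be a function on a convex subset P₀ of P_n taking values in [0,+∞] and satisfying, for all p̄, q̄ ∈ P₀ and λ ∈ [0,1] (with possible value +∞ on both sides), the inequalities f(λp̄+(1−λ)q̄) ≥ λf(p̄)+(1−λ)f(q̄)−a_f(λ) and f(λp̄+(1−λ)q̄) ≤ λf(p̄)+(1−λ)f(q̄)+b_f(λ), where a_f, b_f are continuous functions on [0,1] with a_f(0)=b_f(0)=0, a_f(λ)=a_f(1−λ) and b_f(λ)=b_f(1−λ) for all λ∈[0,1], and a_f, b_f are concave and non-decreasing on [0,1/2]. Let p̄ ∈ P₀ be a distribution such that (a) h(p̄) ∈ cone(P₀) for every function h : ℝ₊ → ℝ₊ with h(x) ≤ x for all x ≥ 0 (where h(p̄) is the entrywise application of h), and (b) the entrywise positive and negative parts [p̄−q̄]₊ and [p̄−q̄]₋ belong to cone(P₀) for every q̄ ∈ P₀ with q̄ ≠ p̄. If f(p̄) < +∞, then for every ε ∈ (0,1] and every q̄ ∈ P₀ with TV(p̄,q̄) ≤ ε one has f(q̄) ≥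 f(p̄) − f̃(p̄∧ε) − D_f(ε) − ã_f(ε), where D_f(ε) = (1+ε)·(a_f+b_f)(ε/(1+ε)) and ã_f(ε) = a_f(ε) for ε ∈ [0,1/2], ã_f(ε) = a_f(1/2) for ε ∈ (1/2,1]. -/
open scoped ENNReal

/-- The set of `n`-variate probability distributions: families of nonnegative reals
indexed by `ℕⁿ` that are summable with total sum `1`. -/
def distrSet (n : ℕ) : Set ((Fin n → ℕ) → ℝ) :=
  {p | (∀ i, 0 ≤ p i) ∧ Summable p ∧ ∑' i, p i = 1}

/-- Total variation distance. -/
noncomputable def TV {n : ℕ} (p q : (Fin n → ℕ) → ℝ) : ℝ :=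
  (1 / 2) * ∑' i, |p i - q i|

/-- The cone generated by a set of distributions. -/
def coneOf {n : ℕ} (P0 : Set ((Fin n → ℕ) → ℝ)) : Set ((Fin n → ℕ) → ℝ) :=
  {a | ∃ c : ℝ, 0 ≤ c ∧ ∃ p ∈ P0, a = c • p}

/-- The homogeneous extension `f̃(ā) = ‖ā‖₁ · f(ā/‖ā‖₁)` (equal to `0` at `ā = 0`). -/
noncomputable def ftilde {n : ℕ} (f : ((Fin n → ℕ) → ℝ) → ℝ≥0∞)
    (a : (Fin n → ℕ) → ℝ) : ℝ≥0∞ :=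
  ENNReal.ofReal (∑' i, a i) * f (fun i => a i / ∑' i, a i)

section Cone

variable {n : ℕ} {P0 : Set ((Fin n → ℕ) → ℝ)} {p : (Fin n → ℕ) → ℝ}

lemma coneOf_nonneg (hP0 : P0 ⊆ distrSet n) {a : (Fin n → ℕ) → ℝ} (ha : a ∈ coneOf P0) (i) :
    0 ≤ a i := by
  obtain ⟨c, hc, x, hx, rfl⟩ := ha
  exact mul_nonneg hc ((hP0 hx).1 i)

lemma coneOf_summable (hP0 : P0 ⊆ distrSet n) {a : (Fin n → ℕ) → ℝ} (ha : a ∈ coneOf P0) :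
    Summable a := by
  obtain ⟨c, hc, x, hx, rfl⟩ := ha
  exact (hP0 hx).2.1.const_smul c

lemma coneOf_normalize (hP0 : P0 ⊆ distrSet n) {a : (Fin n → ℕ) → ℝ} (ha : a ∈ coneOf P0)
    (h0 : ∑' i, a i ≠ 0) : (fun i => a i / ∑' i, a i) ∈ P0 := by
  obtain ⟨c, hc, x, hx, rfl⟩ := ha
  have hs : ∑' i, (c • x) i = c := by
    simp [tsum_mul_left, (hP0 hx).2.2]
  rw [hs] at h0 ⊢
  convert hx using 1
  ext i
  simp [h0]

lemma mem_of_mem_coneOf (hP0 : P0 ⊆ distrSet n) {a : (Fin n → ℕ) → ℝ} (ha : a ∈ coneOf P0)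
    (h1 : ∑' i, a i = 1) : a ∈ P0 := by
  simpa [h1] using coneOf_normalize hP0 ha (by simp [h1])

lemma mem_coneOf {x : (Fin n → ℕ) → ℝ} (hx : x ∈ P0) : x ∈ coneOf P0 :=
  ⟨1, zero_le_one, x, hx, by simp⟩

lemma smul_mem_coneOf {a : (Fin n → ℕ) → ℝ} (ha : a ∈ coneOf P0) {c : ℝ} (hc : 0 ≤ c) :
    c • a ∈ coneOf P0 := by
  obtain ⟨d, hd, x, hx, rfl⟩ := ha
  exact ⟨c * d, mul_nonneg hc hd, x, hx, smul_smul c d x⟩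

lemma zero_mem_coneOf (hp : p ∈ P0) : (0 : (Fin n → ℕ) → ℝ) ∈ coneOf P0 :=
  ⟨0, le_rfl, p, hp, by simp⟩

lemma add_mem_coneOf (hconv : Convex ℝ P0) {a b : (Fin n → ℕ) → ℝ}
    (ha : a ∈ coneOf P0) (hb : b ∈ coneOf P0) : a + b ∈ coneOf P0 := by
  obtain ⟨c, hc, x, hx, rfl⟩ := ha
  obtain ⟨d, hd, y, hy, rfl⟩ := hb
  rcases (add_nonneg hc hd).eq_or_lt with h | h
  · obtain rfl : c = 0 := by linarith
    obtain rfl : d = 0 := by linarith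
    exact ⟨0, le_rfl, x, hx, by simp⟩
  · refine ⟨c + d, h.le, _, hconv hx hy (div_nonneg hc h.le) (div_nonneg hd h.le)
      (by field_simp), ?_⟩
    rw [smul_add, smul_smul, smul_smul, mul_div_cancel₀ _ h.ne', mul_div_cancel₀ _ h.ne']

lemma tsum_pos_of_mem_coneOf (hP0 : P0 ⊆ distrSet n) {a : (Fin n → ℕ) → ℝ}
    (ha : a ∈ coneOf P0) (h0 : a ≠ 0) : 0 < ∑' i, a i := by
  obtain ⟨i, hi⟩ := Function.ne_iff.1 h0
  exact (coneOf_summable hP0 ha).tsum_pos (coneOf_nonneg hP0 ha) i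
    ((coneOf_nonneg hP0 ha i).lt_of_ne' hi)

lemma eq_of_le_of_mem_distrSet {x y : (Fin n → ℕ) → ℝ} (hx : x ∈ distrSet n)
    (hy : y ∈ distrSet n) (h : x ≤ y) : x = y := by
  by_contra hne
  obtain ⟨i, hi⟩ := Function.ne_iff.1 hne
  have := Summable.tsum_lt_tsum h ((h i).lt_of_ne hi) hx.2.1 hy.2.1
  rw [hx.2.2, hy.2.2] at this
  exact this.false

/-- If `p` splits along `A` inside the cone, then parts of `p` can be subtracted on `A`. -/
lemma indicator_sub_mem_coneOf_of_tsum_le (hP0 : P0 ⊆ distrSet n) (hconv : Convex ℝ P0)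
    (hp : p ∈ P0) (hpos : ∀ x ∈ P0, (fun i => max (p i - x i) 0) ∈ coneOf P0)
    {A : Set (Fin n → ℕ)} (hAc : Aᶜ.indicator p ∈ coneOf P0) (hAc0 : Aᶜ.indicator p ≠ 0)
    {y : (Fin n → ℕ) → ℝ} (hy : y ∈ coneOf P0)
    (hmass : ∑' i, y i ≤ ∑' i, A.indicator p i) (hle : ∀ i ∈ A, y i ≤ p i) :
    A.indicator (p - y) ∈ coneOf P0 := by
  have hc := tsum_pos_of_mem_coneOf hP0 hAc hAc0
  set c := ∑' i, Aᶜ.indicator p i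
  have hsum : ∑' i, A.indicator p i + c = 1 := by
    rw [← (hP0 hp).2.2, ← Summable.tsum_add ((hP0 hp).2.1.indicator A)
      ((hP0 hp).2.1.indicator Aᶜ)]
    exact tsum_congr fun i => congrFun (Set.indicator_self_add_compl A p) i
  set d := (1 - ∑' i, y i) / c with hd
  have hd1 : 1 ≤ d := by rw [hd, le_div_iff₀ hc]; linarith
  have hx : y + d • Aᶜ.indicator p ∈ P0 := by
    refine mem_of_mem_coneOf hP0 (add_mem_coneOf hconv hy
      (smul_mem_coneOf hAc (by linarith))) ?_
    simp only [Pi.add_apply, Pi.smul_apply, smul_eq_mul]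
    rw [Summable.tsum_add (coneOf_summable hP0 hy) ((coneOf_summable hP0 hAc).mul_left d),
      tsum_mul_left]
    change _ + d * c = 1
    rw [hd]
    field_simp
    ring
  convert hpos _ hx using 1
  ext i
  by_cases hi : i ∈ A
  · simp [hi, hle i hi]
  · have h1 := (hP0 hp).1 i
    have h2 := coneOf_nonneg hP0 hy i
    simp only [hi, not_false_eq_true, Set.indicator_of_notMem, Pi.add_apply, Pi.smul_apply,
      Set.mem_compl_iff, Set.indicator_of_mem, smul_eq_mul]
    rw [max_eq_right]
    nlinarith

lemma indicator_sub_mem_coneOf (hP0 : P0 ⊆ distrSet n) (hconv : Convex ℝ P0)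
    (hp : p ∈ P0) (hpos : ∀ x ∈ P0, (fun i => max (p i - x i) 0) ∈ coneOf P0)
    {A : Set (Fin n → ℕ)} (hA : A.indicator p ∈ coneOf P0) (hA0 : A.indicator p ≠ 0)
    (hAc : Aᶜ.indicator p ∈ coneOf P0) (hAc0 : Aᶜ.indicator p ≠ 0)
    {y : (Fin n → ℕ) → ℝ} (hy : y ∈ coneOf P0) (hle : y ≤ p) :
    A.indicator (p - y) ∈ coneOf P0 := by
  have hc := tsum_pos_of_mem_coneOf hP0 hA hA0
  set c := ∑' i, A.indicator p i with hcdef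
  have hpS := (hP0 hp).2.1
  have hc1 : c ≤ 1 := by
    rw [← (hP0 hp).2.2]
    exact Summable.tsum_le_tsum (fun i => Set.indicator_le_self' (fun _ _ => (hP0 hp).1 _) i)
      (hpS.indicator A) hpS
  have hy1 : ∑' i, y i ≤ 1 := by
    rw [← (hP0 hp).2.2]
    exact Summable.tsum_le_tsum hle (coneOf_summable hP0 hy) hpS
  have key : ∀ z ∈ coneOf P0, z ≤ A.indicator p → A.indicator (p - z) ∈ coneOf P0 := by
    intro z hz hzle
    refine indicator_sub_mem_coneOf_of_tsum_le hP0 hconv hp hpos hAc hAc0 hz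
      (Summable.tsum_le_tsum hzle (coneOf_summable hP0 hz) (hpS.indicator A)) ?_
    intro i hi
    simpa [hi] using hzle i
  have h1 : A.indicator (p - c • y) ∈ coneOf P0 := by
    refine indicator_sub_mem_coneOf_of_tsum_le hP0 hconv hp hpos hAc hAc0
      (smul_mem_coneOf hy hc.le) ?_ ?_
    · simp only [Pi.smul_apply, smul_eq_mul]
      rw [tsum_mul_left]
      nlinarith
    · intro i _
      have := hle i
      have := coneOf_nonneg hP0 hy i
      simp only [Pi.smul_apply, smul_eq_mul]
      nlinarith
  have h2 : A.indicator y ∈ coneOf P0 := by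
    have h3 := smul_mem_coneOf (key _ h1 ?_) (inv_nonneg.2 hc.le)
    · convert h3 using 1
      ext i
      by_cases hi : i ∈ A
      · simp [hi, hc.ne']
      · simp [hi]
    · intro i
      by_cases hi : i ∈ A
      · simpa [hi] using mul_nonneg hc.le (coneOf_nonneg hP0 hy i)
      · simp [hi]
  convert key _ h2 (fun i => Set.indicator_le_indicator (hle i)) using 1
  ext i
  by_cases hi : i ∈ A <;> simp [hi]

lemma sub_mem_coneOf_of_indicator (hP0 : P0 ⊆ distrSet n) (hconv : Convex ℝ P0)
    (hp : p ∈ P0) (hpos : ∀ x ∈ P0, (fun i => max (p i - x i) 0) ∈ coneOf P0)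
    {A : Set (Fin n → ℕ)} (hA : A.indicator p ∈ coneOf P0) (hA0 : A.indicator p ≠ 0)
    (hAc : Aᶜ.indicator p ∈ coneOf P0) (hAc0 : Aᶜ.indicator p ≠ 0)
    {y : (Fin n → ℕ) → ℝ} (hy : y ∈ coneOf P0) (hle : y ≤ p) :
    p - y ∈ coneOf P0 := by
  rw [← Set.indicator_self_add_compl A (p - y)]
  refine add_mem_coneOf hconv
    (indicator_sub_mem_coneOf hP0 hconv hp hpos hA hA0 hAc hAc0 hy hle)
    (indicator_sub_mem_coneOf hP0 hconv hp hpos hAc hAc0 ?_ ?_ hy hle) <;>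
  rwa [compl_compl]

/-- A distribution that is uniform on a finite support splits inside the cone as soon as the cone
contains an element with smaller support. -/
lemma exists_indicator_mem_coneOf_of_support_ssubset (hP0 : P0 ⊆ distrSet n)
    (hp : p ∈ P0) (hpos : ∀ x ∈ P0, (fun i => max (p i - x i) 0) ∈ coneOf P0)
    (hneg : ∀ x ∈ P0, (fun i => max (x i - p i) 0) ∈ coneOf P0)
    (hfin : (Function.support p).Finite)
    {z : (Fin n → ℕ) → ℝ} (hz : z ∈ coneOf P0) (hz0 : z ≠ 0)
    (hsupp : Function.support z ⊂ Function.support p) :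
    ∃ A : Set (Fin n → ℕ), A.indicator p ∈ coneOf P0 ∧ A.indicator p ≠ 0 ∧
      Aᶜ.indicator p ∈ coneOf P0 ∧ Aᶜ.indicator p ≠ 0 := by
  induction hm : (Function.support z).ncard using Nat.strong_induction_on generalizing z with
  | _ m ih =>
  have hmass := tsum_pos_of_mem_coneOf hP0 hz hz0
  set x : (Fin n → ℕ) → ℝ := fun i => z i / ∑' i, z i with hxdef
  have hx : x ∈ P0 := coneOf_normalize hP0 hz hmass.ne'
  have hxs : Function.support x = Function.support z := by
    ext i; simp [hxdef, hmass.ne']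
  have hp0 := (hP0 hp).1
  have hsub : Function.support (fun i => max (x i - p i) 0) ⊆ Function.support z := by
    intro i hi
    rw [← hxs]
    contrapose! hi
    have : x i = 0 := by simpa using hi
    simp [this, hp0 i]
  rcases hsub.eq_or_ssubset with heq | hlt
  · have hgt : ∀ i ∈ Function.support z, p i ≤ x i := by
      intro i hi
      rw [← heq] at hi
      by_contra! hlt
      exact hi (max_eq_right (by linarith))
    have hB : (Function.support z)ᶜ.indicator p ∈ coneOf P0 := by
      convert hpos x hx using 1
      ext i
      by_cases hi : i ∈ Function.support z
      · simp only [hi, Set.mem_compl_iff, not_true_eq_false, not_false_eq_true,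
          Set.indicator_of_notMem]
        rw [max_eq_right]
        linarith [hgt i hi]
      · have : x i = 0 := by rw [← hxs] at hi; simpa using hi
        simp only [hi, Set.mem_compl_iff, not_false_eq_true, Set.indicator_of_mem, this, sub_zero]
        rw [max_eq_left (hp0 i)]
    have hB0 : (Function.support z)ᶜ.indicator p ≠ 0 := by
      obtain ⟨i, hi, hi'⟩ := Set.exists_of_ssubset hsupp
      intro h
      have := congrFun h i
      rw [Set.indicator_of_mem hi'] at this
      exact hi this
    have hA0 : (Function.support z).indicator p ≠ 0 := by
      obtain ⟨i, hi⟩ := Function.support_nonempty_iff.2 hz0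
      intro h
      have := congrFun h i
      rw [Set.indicator_of_mem hi] at this
      exact hsupp.1 hi this
    refine ⟨Function.support z, ?_, hA0, hB, hB0⟩
    have hc := tsum_pos_of_mem_coneOf hP0 hB hB0
    have hc1 : ∑' i, (Function.support z)ᶜ.indicator p i ≤ 1 := by
      rw [← (hP0 hp).2.2]
      exact Summable.tsum_le_tsum
        (fun i => Set.indicator_le_self' (fun _ _ => hp0 _) i)
        ((hP0 hp).2.1.indicator _) (hP0 hp).2.1
    convert hpos _ (coneOf_normalize hP0 hB hc.ne') using 1
    ext i
    by_cases hi : i ∈ Function.support z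
    · rw [Set.indicator_of_mem hi, Set.indicator_of_notMem (by simpa using hi)]
      simp [hp0 i]
    · rw [Set.indicator_of_notMem hi, Set.indicator_of_mem (Set.mem_compl hi), max_eq_right]
      rw [sub_nonpos]
      exact le_div_self (hp0 i) hc hc1
  · refine ih _ ?_ (hneg x hx) ?_ (hlt.trans hsupp) rfl
    · rw [← hm]
      exact Set.ncard_lt_ncard hlt (hfin.subset hsupp.1)
    · intro h
      have hle : x ≤ p := by
        intro i
        have := congrFun h i
        simpa using this
      have hxp := eq_of_le_of_mem_distrSet (hP0 hx) (hP0 hp) hle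
      rw [← hxs, hxp] at hsupp
      exact hsupp.ne rfl

theorem sub_mem_coneOf (hP0 : P0 ⊆ distrSet n) (hconv : Convex ℝ P0) (hp : p ∈ P0)
    (hfun : ∀ h : ℝ → ℝ, (∀ x : ℝ, 0 ≤ x → 0 ≤ h x ∧ h x ≤ x) →
      (fun i => h (p i)) ∈ coneOf P0)
    (hpos : ∀ x ∈ P0, (fun i => max (p i - x i) 0) ∈ coneOf P0)
    (hneg : ∀ x ∈ P0, (fun i => max (x i - p i) 0) ∈ coneOf P0)
    {y : (Fin n → ℕ) → ℝ} (hy : y ∈ coneOf P0) (hle : y ≤ p) :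
    p - y ∈ coneOf P0 := by
  classical
  have hp0 := (hP0 hp).1
  by_cases hconst : ∃ i j, 0 < p i ∧ 0 < p j ∧ p i ≠ p j
  · obtain ⟨i, j, hi, hj, hij⟩ := hconst
    have hA : {k | p k = p i}.indicator p ∈ coneOf P0 := by
      convert hfun (fun x => if x = p i then x else 0) ?_ using 1
      · ext k
        by_cases hk : p k = p i <;> simp [hk]
      · intro x hx
        split_ifs <;> simp [hx]
    have hAc : {k | p k = p i}ᶜ.indicator p ∈ coneOf P0 := by
      convert hfun (fun x => if x = p i then 0 else x) ?_ using 1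
      · ext k
        by_cases hk : p k = p i <;> simp [hk]
      · intro x hx
        split_ifs <;> simp [hx]
    refine sub_mem_coneOf_of_indicator hP0 hconv hp hpos hA ?_ hAc ?_ hy hle
    · intro h
      have := congrFun h i
      simp [hi.ne'] at this
    · intro h
      have := congrFun h j
      simp [hij.symm, hj.ne'] at this
  push Not at hconst
  have hfin : (Function.support p).Finite := by
    by_cases hne : ∃ i, 0 < p i
    · obtain ⟨i, hi⟩ := hne
      have h1 := (hP0 hp).2.1.tendsto_cofinite_zero.eventually (gt_mem_nhds hi)
      refine (Filter.eventually_cofinite.1 h1).subset ?_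
      intro k hk
      have : 0 < p k := (hp0 k).lt_of_ne' hk
      simp [hconst k i this hi]
    · push Not at hne
      convert Set.finite_empty
      ext k
      simpa using le_antisymm (hne k) (hp0 k)
  by_cases hy0 : y = 0
  · simpa [hy0] using mem_coneOf hp
  have hmass := tsum_pos_of_mem_coneOf hP0 hy hy0
  have hy1 : ∑' i, y i ≤ 1 := by
    rw [← (hP0 hp).2.2]
    exact Summable.tsum_le_tsum hle (coneOf_summable hP0 hy) (hP0 hp).2.1
  have hx := coneOf_normalize hP0 hy hmass.ne'
  set x : (Fin n → ℕ) → ℝ := fun i => y i / ∑' i, y i with hxdef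
  by_cases hxp : x = p
  · have : p - y = (1 - ∑' i, y i) • p := by
      rw [sub_smul, one_smul]
      congr 1
      ext i
      rw [← hxp]
      simp only [hxdef, Pi.smul_apply, smul_eq_mul]
      field_simp
    rw [this]
    exact smul_mem_coneOf (mem_coneOf hp) (by linarith)
  have hne0 : (fun i => max (x i - p i) 0) ≠ 0 := fun h =>
    hxp (eq_of_le_of_mem_distrSet (hP0 hx) (hP0 hp) fun i => by simpa using congrFun h i)
  have hsupp : Function.support (fun i => max (x i - p i) 0) ⊂ Function.support p := by
    refine Set.ssubset_iff_subset_ne.2 ⟨?_, fun h => ?_⟩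
    · intro i hi hpi
      have hyi : y i = 0 := le_antisymm ((hle i).trans hpi.le) (coneOf_nonneg hP0 hy i)
      exact hi (by simp [hxdef, hyi, hp0 i])
    · refine hxp (eq_of_le_of_mem_distrSet (hP0 hp) (hP0 hx) fun i => ?_).symm
      by_cases hi : i ∈ Function.support p
      · rw [← h] at hi
        by_contra! hlt
        exact hi (max_eq_right (by linarith))
      · rw [show p i = 0 by simpa using hi]
        exact (hP0 hx).1 i
  obtain ⟨A, hA, hA0, hAc, hAc0⟩ := exists_indicator_mem_coneOf_of_support_ssubset hP0 hp hpos hneg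
    hfin (hneg x hx) hne0 hsupp
  exact sub_mem_coneOf_of_indicator hP0 hconv hp hpos hA hA0 hAc hAc0 hy hle

end Cone

section Modulus

variable {g : ℝ → ℝ}

lemma modulus_nonneg (h0 : g 0 = 0) (hmono : MonotoneOn g (Set.Icc 0 (1 / 2)))
    {l : ℝ} (hl : l ∈ Set.Icc (0 : ℝ) (1 / 2)) : 0 ≤ g l := by
  rw [← h0]
  exact hmono ⟨le_rfl, by norm_num⟩ hl hl.1

lemma one_add_mul_modulus_mono (h0 : g 0 = 0) (hmono : MonotoneOn g (Set.Icc 0 (1 / 2)))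
    {δ ε : ℝ} (hδ : 0 ≤ δ) (hδε : δ ≤ ε) (hε : ε ≤ 1) :
    (1 + δ) * g (δ / (1 + δ)) ≤ (1 + ε) * g (ε / (1 + ε)) := by
  have hmem : ∀ t : ℝ, 0 ≤ t → t ≤ 1 → t / (1 + t) ∈ Set.Icc (0 : ℝ) (1 / 2) := by
    intro t ht ht1
    refine ⟨by positivity, ?_⟩
    rw [div_le_iff₀ (by linarith)]
    linarith
  refine mul_le_mul (by linarith) (hmono (hmem δ hδ (by linarith)) (hmem ε (by linarith) hε) ?_)
    (modulus_nonneg h0 hmono (hmem δ hδ (by linarith))) (by linarith)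
  rw [div_le_div_iff₀ (by linarith) (by linarith)]
  nlinarith

lemma mul_le_modulus_mul (h0 : g 0 = 0) (hconc : ConcaveOn ℝ (Set.Icc 0 (1 / 2)) g)
    {t l : ℝ} (ht : t ∈ Set.Icc (0 : ℝ) 1) (hl : l ∈ Set.Icc (0 : ℝ) (1 / 2)) :
    t * g l ≤ g (t * l) := by
  have := hconc.2 hl ⟨le_rfl, by norm_num⟩ ht.1 (sub_nonneg.2 ht.2) (by ring)
  simpa [h0] using this

lemma mul_modulus_div_le (h0 : g 0 = 0) (hsym : ∀ l ∈ Set.Icc (0 : ℝ) 1, g l = g (1 - l))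
    (hconc : ConcaveOn ℝ (Set.Icc 0 (1 / 2)) g) (hmono : MonotoneOn g (Set.Icc 0 (1 / 2)))
    {δ x ε : ℝ} (hδ : 0 < δ) (hδx : δ ≤ x) (hx : x ≤ 1) (hδε : δ ≤ ε) :
    x * g (δ / x) ≤ if ε ≤ 1 / 2 then g ε else g (1 / 2) := by
  have hx0 : 0 < x := hδ.trans_le hδx
  have hhalf : (1 / 2 : ℝ) ∈ Set.Icc (0 : ℝ) (1 / 2) := by norm_num
  have hg2 := modulus_nonneg h0 hmono hhalf
  have hl1 : δ / x ≤ 1 := (div_le_one hx0).2 hδx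
  have hl0 : 0 < δ / x := by positivity
  have hle : g (δ / x) ≤ g (1 / 2) := by
    by_cases h : δ / x ≤ 1 / 2
    · exact hmono ⟨hl0.le, h⟩ hhalf h
    · rw [hsym _ ⟨hl0.le, hl1⟩]
      exact hmono ⟨by linarith, by linarith⟩ hhalf (by linarith)
  by_cases hδ2 : δ ≤ 1 / 2
  · have hδg : g δ ≤ if ε ≤ 1 / 2 then g ε else g (1 / 2) := by
      split_ifs with h
      · exact hmono ⟨hδ.le, hδ2⟩ ⟨by linarith, h⟩ hδε
      · exact hmono ⟨hδ.le, hδ2⟩ hhalf hδ2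
    refine le_trans ?_ hδg
    by_cases h : δ / x ≤ 1 / 2
    · have := mul_le_modulus_mul h0 hconc ⟨hx0.le, hx⟩ ⟨hl0.le, h⟩
      rwa [mul_div_cancel₀ _ hx0.ne'] at this
    · have h2 : x ≤ 2 * δ := by
        rw [not_le, lt_div_iff₀ hx0] at h
        linarith
      have := mul_le_modulus_mul h0 hconc ⟨by linarith, by linarith⟩ hhalf (t := 2 * δ)
      rw [show 2 * δ * (1 / 2) = δ by ring] at this
      calc x * g (δ / x) ≤ x * g (1 / 2) := by gcongr
        _ ≤ 2 * δ * g (1 / 2) := by gcongr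
        _ ≤ g δ := this
  · rw [if_neg (by linarith)]
    nlinarith

end Modulus

lemma ENNReal.le_add_of_ofReal_mul_le {a b c : ℝ≥0∞} {l d A B : ℝ} (hl : 0 < l)
    (hA : 0 ≤ A) (hB : 0 ≤ B)
    (h : ENNReal.ofReal l * a ≤ ENNReal.ofReal l * b + ENNReal.ofReal (l * d) * c
      + ENNReal.ofReal A + ENNReal.ofReal B) :
    a ≤ b + ENNReal.ofReal d * c + ENNReal.ofReal (l⁻¹ * (A + B)) := by
  have h1 : ENNReal.ofReal l ≠ 0 := by simpa using hl
  rw [← ENNReal.mul_le_mul_iff_right h1 ENNReal.ofReal_ne_top]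
  refine h.trans_eq ?_
  rw [mul_add, mul_add, ← ENNReal.ofReal_mul hl.le, mul_inv_cancel_left₀ hl.ne',
    ENNReal.ofReal_add hA hB, ENNReal.ofReal_mul hl.le, mul_assoc, add_assoc, add_assoc]

lemma ftilde_le_ftilde_add {n : ℕ} {P0 : Set ((Fin n → ℕ) → ℝ)} (hP0 : P0 ⊆ distrSet n)
    {f : ((Fin n → ℕ) → ℝ) → ℝ≥0∞} {af : ℝ → ℝ}
    (hlow : ∀ p ∈ P0, ∀ q ∈ P0, ∀ l ∈ Set.Icc (0 : ℝ) 1,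
      ENNReal.ofReal l * f p + ENNReal.ofReal (1 - l) * f q
        ≤ f (l • p + (1 - l) • q) + ENNReal.ofReal (af l))
    {s u : (Fin n → ℕ) → ℝ} (hs : s ∈ coneOf P0) (hu : u ∈ coneOf P0) (hs0 : s ≠ 0) :
    ftilde f s ≤ ftilde f (s + u) + ENNReal.ofReal
      ((∑' i, (s + u) i) * af ((∑' i, s i) / ∑' i, (s + u) i)) := by
  by_cases hu0 : u = 0
  · simp [hu0]
  have hms := tsum_pos_of_mem_coneOf hP0 hs hs0
  have hmu := tsum_pos_of_mem_coneOf hP0 hu hu0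
  have hsum : ∑' i, (s + u) i = ∑' i, s i + ∑' i, u i :=
    Summable.tsum_add (coneOf_summable hP0 hs) (coneOf_summable hP0 hu)
  have hS := coneOf_normalize hP0 hs hms.ne'
  have hU := coneOf_normalize hP0 hu hmu.ne'
  unfold ftilde
  rw [hsum]
  set δ := ∑' i, s i
  set η := ∑' i, u i
  have hx : 0 < δ + η := by linarith
  have h := hlow _ hS _ hU (δ / (δ + η)) ⟨by positivity, by rw [div_le_one hx]; linarith⟩
  have hmix : (δ / (δ + η)) • (fun i => s i / δ) + (1 - δ / (δ + η)) • (fun i => u i / η)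
      = fun i => (s + u) i / (δ + η) := by
    ext i
    simp only [Pi.add_apply, Pi.smul_apply, smul_eq_mul]
    field_simp
    ring
  rw [hmix] at h
  have h' := mul_le_mul_right (le_self_add.trans h) (ENNReal.ofReal (δ + η))
  rwa [← mul_assoc, ← ENNReal.ofReal_mul hx.le, mul_div_cancel₀ _ hx.ne', mul_add,
    ← ENNReal.ofReal_mul hx.le] at h'

/-- Lemma 2A of the paper, classical version: local lower bound
`f(q̄) ≥ f(p̄) − f̃(p̄∧ε) − D_f(ε) − ã_f(ε)` for a locally almost affine nonnegative
function `f` on a convex subset `P₀` of the set of `n`-variate probability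
distributions, stated in `[0,+∞]` as
`f(p̄) ≤ f(q̄) + f̃(p̄∧ε) + D_f(ε) + ã_f(ε)`. -/
theorem LAA_local_lower_bound_A {n : ℕ}
    (P0 : Set ((Fin n → ℕ) → ℝ)) (hP0 : P0 ⊆ distrSet n) (hP0conv : Convex ℝ P0)
    (f : ((Fin n → ℕ) → ℝ) → ℝ≥0∞) (af bf : ℝ → ℝ)
    (haf_cont : ContinuousOn af (Set.Icc 0 1)) (hbf_cont : ContinuousOn bf (Set.Icc 0 1))
    (haf0 : af 0 = 0) (hbf0 : bf 0 = 0)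
    (haf_sym : ∀ l ∈ Set.Icc (0 : ℝ) 1, af l = af (1 - l))
    (hbf_sym : ∀ l ∈ Set.Icc (0 : ℝ) 1, bf l = bf (1 - l))
    (haf_conc : ConcaveOn ℝ (Set.Icc 0 (1 / 2)) af)
    (hbf_conc : ConcaveOn ℝ (Set.Icc 0 (1 / 2)) bf)
    (haf_mono : MonotoneOn af (Set.Icc 0 (1 / 2)))
    (hbf_mono : MonotoneOn bf (Set.Icc 0 (1 / 2)))
    (hlow : ∀ p ∈ P0, ∀ q ∈ P0, ∀ l ∈ Set.Icc (0 : ℝ) 1,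
      ENNReal.ofReal l * f p + ENNReal.ofReal (1 - l) * f q
        ≤ f (l • p + (1 - l) • q) + ENNReal.ofReal (af l))
    (hup : ∀ p ∈ P0, ∀ q ∈ P0, ∀ l ∈ Set.Icc (0 : ℝ) 1,
      f (l • p + (1 - l) • q)
        ≤ ENNReal.ofReal l * f p + ENNReal.ofReal (1 - l) * f q + ENNReal.ofReal (bf l))
    (p : (Fin n → ℕ) → ℝ) (hp : p ∈ P0)
    (hconea : ∀ h : ℝ → ℝ, (∀ x : ℝ, 0 ≤ x → 0 ≤ h x ∧ h x ≤ x) →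
      (fun i => h (p i)) ∈ coneOf P0)
    (hconeb : ∀ q ∈ P0, q ≠ p →
      (fun i => max (p i - q i) 0) ∈ coneOf P0 ∧ (fun i => max (q i - p i) 0) ∈ coneOf P0)
    (hfp : f p ≠ ∞)
    (ε : ℝ) (hε : ε ∈ Set.Ioc (0 : ℝ) 1)
    (q : (Fin n → ℕ) → ℝ) (hq : q ∈ P0) (hTV : TV p q ≤ ε) :
    f p ≤ f q + ftilde f (fun i => min (p i) ε)
      + ENNReal.ofReal ((1 + ε) * (af (ε / (1 + ε)) + bf (ε / (1 + ε))))
      + ENNReal.ofReal (if ε ≤ 1 / 2 then af ε else af (1 / 2)) := by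
  by_cases hqp : q = p
  · rw [hqp, add_assoc, add_assoc]
    exact le_self_add
  obtain ⟨hs, hv⟩ := hconeb q hq hqp
  have hpos : ∀ x ∈ P0, (fun i => max (p i - x i) 0) ∈ coneOf P0 := by
    intro x hx
    by_cases h : x = p
    · simp only [h, sub_self, max_self]
      exact zero_mem_coneOf hp
    · exact (hconeb x hx h).1
  have hneg : ∀ x ∈ P0, (fun i => max (x i - p i) 0) ∈ coneOf P0 := by
    intro x hx
    by_cases h : x = p
    · simp only [h, sub_self, max_self]
      exact zero_mem_coneOf hp
    · exact (hconeb x hx h).2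
  set s : (Fin n → ℕ) → ℝ := fun i => max (p i - q i) 0 with hsdef
  set v : (Fin n → ℕ) → ℝ := fun i => max (q i - p i) 0 with hvdef
  have hp0 := (hP0 hp).1
  have hq0 := (hP0 hq).1
  have hsS := coneOf_summable hP0 hs
  have hvS := coneOf_summable hP0 hv
  have hs0 : s ≠ 0 := fun h =>
    hqp (eq_of_le_of_mem_distrSet (hP0 hp) (hP0 hq) fun i => by
      simpa [hsdef] using congrFun h i).symm
  have hδ := tsum_pos_of_mem_coneOf hP0 hs hs0
  have hpq : ∀ i, p i + v i = q i + s i := by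
    intro i
    simp only [hsdef, hvdef]
    rcases le_total (p i) (q i) with h | h
    · rw [max_eq_left (by linarith), max_eq_right (by linarith)]; ring
    · rw [max_eq_right (by linarith), max_eq_left (by linarith)]; ring
  have hsv : ∑' i, v i = ∑' i, s i := by
    have : ∑' i, (p i + v i) = ∑' i, (q i + s i) := tsum_congr hpq
    rw [Summable.tsum_add (hP0 hp).2.1 hvS, Summable.tsum_add (hP0 hq).2.1 hsS, (hP0 hp).2.2,
      (hP0 hq).2.2] at this
    linarith
  have hδε : ∑' i, s i ≤ ε := by
    have habs : ∀ i, |p i - q i| = s i + v i := by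
      intro i
      simp only [hsdef, hvdef]
      rcases le_total (p i) (q i) with h | h
      · rw [max_eq_right (by linarith), max_eq_left (by linarith), abs_of_nonpos (by linarith)]
        ring
      · rw [max_eq_left (by linarith), max_eq_right (by linarith), abs_of_nonneg (by linarith)]
        ring
    rw [TV, tsum_congr habs, Summable.tsum_add hsS hvS, hsv] at hTV
    linarith
  have hT := coneOf_normalize hP0 hs hδ.ne'
  have hV := coneOf_normalize hP0 hv (hsv ▸ hδ.ne')
  rw [hsv] at hV
  have hr : (fun i => min (p i) ε) ∈ coneOf P0 :=
    hconea (fun x => min x ε) fun x hx => ⟨le_min hx hε.1.le, min_le_left _ _⟩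
  have hw : (fun i => max (p i - ε) 0) ∈ coneOf P0 :=
    hconea (fun x => max (x - ε) 0) fun x hx =>
      ⟨le_max_right _ _, max_le (by linarith [hε.1]) hx⟩
  have hsr : ∀ i, s i ≤ min (p i) ε := fun i =>
    le_min (max_le (by linarith [hq0 i]) (hp0 i))
      ((hsS.le_tsum i fun j _ => le_max_right _ _).trans hδε)
  have hrw : ∀ i, min (p i) ε + max (p i - ε) 0 = p i := by
    intro i
    rcases le_total (p i) ε with h | h
    · rw [min_eq_left h, max_eq_right (by linarith), add_zero]
    · rw [min_eq_right h, max_eq_left (by linarith)]; ring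
  have hu := sub_mem_coneOf hP0 hP0conv hp hconea hpos hneg (add_mem_coneOf hP0conv hs hw)
    (fun i => by simpa using by linarith [hsr i, hrw i])
  have hsu : s + (p - (s + fun i => max (p i - ε) 0)) = fun i => min (p i) ε := by
    ext i
    simp only [Pi.add_apply, Pi.sub_apply]
    linarith [hrw i]
  have hftilde := ftilde_le_ftilde_add hP0 hlow hs hu hs0
  rw [hsu] at hftilde
  have hrS := coneOf_summable hP0 hr
  have hmod := mul_modulus_div_le haf0 haf_sym haf_conc haf_mono hδ
    (Summable.tsum_le_tsum hsr hsS hrS)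
    ((Summable.tsum_le_tsum (fun i => min_le_left _ _) hrS (hP0 hp).2.1).trans_eq (hP0 hp).2.2)
    hδε
  replace hftilde := hftilde.trans (add_le_add_right (ENNReal.ofReal_le_ofReal hmod) _)
  have hDa := one_add_mul_modulus_mono haf0 haf_mono hδ.le hδε hε.2
  have hDb := one_add_mul_modulus_mono hbf0 hbf_mono hδ.le hδε hε.2
  unfold ftilde at hftilde ⊢
  set δ := ∑' i, s i
  have h1δ : 0 < 1 + δ := by linarith
  have hl : (1 + δ)⁻¹ ∈ Set.Icc (0 : ℝ) 1 :=
    ⟨by positivity, inv_le_one_of_one_le₀ (by linarith)⟩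
  have hcompl : 1 - (1 + δ)⁻¹ = δ / (1 + δ) := by field_simp; ring
  have hhalf : δ / (1 + δ) ∈ Set.Icc (0 : ℝ) (1 / 2) := by
    refine ⟨by positivity, ?_⟩
    rw [div_le_iff₀ h1δ]
    linarith [hε.2]
  have h1 := le_self_add.trans (hlow p hp _ hV _ hl)
  have h2 := hup q hq _ hT _ hl
  rw [haf_sym _ hl, hcompl] at h1
  rw [hbf_sym _ hl, hcompl] at h2
  have hmix : (1 + δ)⁻¹ • p + (δ / (1 + δ)) • (fun i => v i / δ)
      = (1 + δ)⁻¹ • q + (δ / (1 + δ)) • (fun i => s i / δ) := by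
    ext i
    simp only [Pi.add_apply, Pi.smul_apply, smul_eq_mul]
    field_simp
    exact hpq i
  rw [hmix] at h1
  have h3 := h1.trans (add_le_add_left h2 _)
  rw [div_eq_inv_mul δ] at h3
  have h4 := ENNReal.le_add_of_ofReal_mul_le (by positivity)
    (modulus_nonneg hbf0 hbf_mono (by rwa [← div_eq_inv_mul]))
    (modulus_nonneg haf0 haf_mono (by rwa [← div_eq_inv_mul])) h3
  rw [inv_inv, ← div_eq_inv_mul] at h4
  have hD : (1 + δ) * (bf (δ / (1 + δ)) + af (δ / (1 + δ)))
      ≤ (1 + ε) * (af (ε / (1 + ε)) + bf (ε / (1 + ε))) := by linarith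
  refine (h4.trans (add_le_add (add_le_add_right hftilde _)
    (ENNReal.ofReal_le_ofReal hD))).trans_eq ?_
  ring
end

section
/- Let p̄ = (p_i) and q̄ = (q_i) be probability distributions on ℕ and ε ∈ (0,1] with TV(p̄,q̄) ≤ ε. Then H(q̄) ≥ H̃([p̄−ε]₊) − g(ε), where H̃([p̄−ε]₊) = ∑_{i ∈ I_ε} η(p_i−ε) − η(c_ε) with I_ε the (finite) set of all i such that p_i > ε and c_ε = ∑_{i ∈ I_ε} (p_i−ε). -/
open scoped ENNReal

/-- The Shannon entropy `H(p̄) = ∑ᵢ η(pᵢ) ∈ [0,+∞]`, where `η(x) = −x·ln x`. -/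
noncomputable def shannonEnt (p : ℕ → ℝ) : ℝ≥0∞ :=
  ∑' i, ENNReal.ofReal (Real.negMulLog (p i))

/-- `g(x) = (x+1)·ln(x+1) − x·ln x`. -/
noncomputable def gFun (x : ℝ) : ℝ := (x + 1) * Real.log (x + 1) - x * Real.log x

/-- In a family of total sum zero, every term is at most half of the `ℓ¹` norm. -/
lemma two_mul_le_tsum_abs_of_tsum_eq_zero {d : ℕ → ℝ} (hd : Summable d) (h0 : ∑' i, d i = 0)
    (i : ℕ) : 2 * d i ≤ ∑' j, |d j| := by
  have hsum : ∑' j, (|d j| + d j) = ∑' j, |d j| := by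
    rw [hd.abs.tsum_add hd, h0, add_zero]
  have hle := (hd.abs.add hd).le_tsum i fun j _ ↦ by linarith [neg_abs_le (d j)]
  linarith [le_abs_self (d i)]

lemma gFun_nonneg {x : ℝ} (hx0 : 0 ≤ x) (hx1 : x ≤ 1) : 0 ≤ gFun x := by
  have h1 : 0 ≤ (x + 1) * Real.log (x + 1) :=
    mul_nonneg (by linarith) (Real.log_nonneg (by linarith))
  have h2 := Real.negMulLog_nonneg hx0 hx1
  rw [Real.negMulLog] at h2
  unfold gFun
  linarith

/-- A pointwise form of Gibbs' inequality for `a ≤ q`. -/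
lemma negMulLog_add_mul_log_le {a c q : ℝ} (ha : 0 ≤ a) (haq : a ≤ q) (hq : q ≤ 1) (hc : 0 < c) :
    Real.negMulLog a + a * Real.log c ≤ Real.negMulLog q + (c * q - a) := by
  rcases ha.eq_or_lt with rfl | ha
  · have := Real.negMulLog_nonneg haq hq
    have := mul_nonneg hc.le haq
    simp only [Real.negMulLog_zero, zero_mul]
    linarith
  · have hq0 : 0 < q := ha.trans_le haq
    have hlog : Real.log (c * q / a) = Real.log c + Real.log q - Real.log a := by
      rw [Real.log_div (by positivity) ha.ne', Real.log_mul hc.ne' hq0.ne']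
    have h1 : a * Real.log (c * q / a) ≤ a * (c * q / a - 1) :=
      mul_le_mul_of_nonneg_left (Real.log_le_sub_one_of_pos (by positivity)) ha.le
    have h2 : a * (c * q / a - 1) = c * q - a := by field_simp
    have h3 : 0 ≤ (q - a) * -Real.log q :=
      mul_nonneg (by linarith) (by linarith [Real.log_nonpos hq0.le hq])
    rw [hlog, h2] at h1
    simp only [Real.negMulLog]
    linarith

/-- Monotonicity of the homogeneous extension of the entropy for finite families dominated by a
subprobability distribution. -/
lemma sum_negMulLog_sub_negMulLog_sum_le {ι : Type*} (s : Finset ι) (a q : ι → ℝ)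
    (ha : ∀ i ∈ s, 0 ≤ a i) (haq : ∀ i ∈ s, a i ≤ q i) (hq : ∑ i ∈ s, q i ≤ 1) :
    ∑ i ∈ s, Real.negMulLog (a i) - Real.negMulLog (∑ i ∈ s, a i)
      ≤ ∑ i ∈ s, Real.negMulLog (q i) := by
  have hq0 : ∀ i ∈ s, 0 ≤ q i := fun i hi ↦ (ha i hi).trans (haq i hi)
  have hq1 : ∀ i ∈ s, q i ≤ 1 := fun i hi ↦ (Finset.single_le_sum hq0 hi).trans hq
  rcases (Finset.sum_nonneg ha).eq_or_lt with hc | hc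
  · have hz := (Finset.sum_eq_zero_iff_of_nonneg ha).1 hc.symm
    rw [← hc, Finset.sum_eq_zero fun i hi ↦ by rw [hz i hi, Real.negMulLog_zero],
      Real.negMulLog_zero, sub_zero]
    exact Finset.sum_nonneg fun i hi ↦ Real.negMulLog_nonneg (hq0 i hi) (hq1 i hi)
  · have h := Finset.sum_le_sum fun i hi ↦
      negMulLog_add_mul_log_le (ha i hi) (haq i hi) (hq1 i hi) hc
    simp only [Finset.sum_add_distrib, Finset.sum_sub_distrib, ← Finset.sum_mul,
      ← Finset.mul_sum] at h
    have := mul_le_mul_of_nonneg_left hq hc.le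
    rw [Real.negMulLog.eq_1 (∑ i ∈ s, a i)]
    linarith

/-- if `p̄, q̄` are probability distributions on `ℕ` with `TV(p̄,q̄) ≤ ε`,
`ε ∈ (0,1]`, then `H(q̄) ≥ H̃([p̄−ε]₊) − g(ε)`, where
`H̃([p̄−ε]₊) = ∑ᵢ η(max(pᵢ−ε,0)) − η(∑ᵢ max(pᵢ−ε,0))` (a finite sum). -/
theorem shannonEnt_local_lower_bound (p q : ℕ → ℝ)
    (hp0 : ∀ i, 0 ≤ p i) (hps : Summable p) (hp1 : ∑' i, p i = 1)
    (hq0 : ∀ i, 0 ≤ q i) (hqs : Summable q) (hq1 : ∑' i, q i = 1)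
    (ε : ℝ) (hε : ε ∈ Set.Ioc (0 : ℝ) 1)
    (hTV : (1 / 2) * ∑' i, |p i - q i| ≤ ε) :
    ENNReal.ofReal
        ((∑' i, Real.negMulLog (max (p i - ε) 0))
          - Real.negMulLog (∑' i, max (p i - ε) 0) - gFun ε)
      ≤ shannonEnt q := by
  obtain ⟨hε0, hε1⟩ := hε
  have hpq (i : ℕ) : p i - ε ≤ q i := by
    have h := two_mul_le_tsum_abs_of_tsum_eq_zero (hps.sub hqs)
      (by rw [hps.tsum_sub hqs, hp1, hq1, sub_self]) i
    linarith
  have hfin : {i | ε < p i}.Finite := by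
    have h := hps.tendsto_cofinite_zero.eventually (eventually_lt_nhds hε0)
    exact Set.Finite.subset h fun i (hi : ε < p i) ↦ not_lt.2 hi.le
  set s := hfin.toFinset with hs
  have hout : ∀ i ∉ s, max (p i - ε) 0 = 0 := fun i hi ↦ by
    have : p i ≤ ε := by simpa [hs] using hi
    exact max_eq_right (by linarith)
  have hqle (i : ℕ) : q i ≤ 1 := hq1 ▸ hqs.le_tsum i fun j _ ↦ hq0 j
  rw [tsum_eq_sum hout, tsum_eq_sum (s := s) fun i hi ↦ by rw [hout i hi, Real.negMulLog_zero]]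
  have hmain := sum_negMulLog_sub_negMulLog_sum_le s (fun i ↦ max (p i - ε) 0) q
    (fun i _ ↦ le_max_right _ _) (fun i _ ↦ max_le (hpq i) (hq0 i))
    (hq1 ▸ hqs.sum_le_tsum s fun i _ ↦ hq0 i)
  calc
    _ ≤ ENNReal.ofReal (∑ i ∈ s, Real.negMulLog (q i)) :=
      ENNReal.ofReal_le_ofReal (by linarith [gFun_nonneg hε0.le hε1])
    _ = ∑ i ∈ s, ENNReal.ofReal (Real.negMulLog (q i)) :=
      ENNReal.ofReal_sum_of_nonneg fun i _ ↦ Real.negMulLog_nonneg (hq0 i) (hqle i)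
    _ ≤ shannonEnt q := ENNReal.sum_le_tsum s
end

section
/- Let p̄ = (p_i) be a probability distribution on ℕ with finite Shannon entropy H(p̄) < +∞, let ε ∈ (0,1], and let q̄ = (q_i) be any probability distribution on ℕ with TV(p̄,q̄) ≤ ε. Then H(q̄) ≥ H(p̄) − H̃(p̄∧ε) − g(ε), where H̃(p̄∧ε) = ∑_i η(min(p_i,ε)) − η(∑_i min(p_i,ε)). -/
open scoped ENNReal

theorem Real.negMulLog_add_mul_log_mono {a d A D : ℝ} (ha : 0 ≤ a) (hd : 0 ≤ d)
    (haA : a ≤ A) (hdD : d ≤ D) :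
    Real.negMulLog a + a * Real.log A
      ≤ Real.negMulLog (a + d) + (a + d) * Real.log (A + D) := by
  simp only [Real.negMulLog]
  rcases hd.eq_or_lt with rfl | hd'
  · rcases ha.eq_or_lt with rfl | ha'
    · simp
    have h := Real.log_le_log (by linarith : 0 < A) (by linarith : A ≤ A + D)
    have := mul_le_mul_of_nonneg_left h ha
    simpa using this
  rcases ha.eq_or_lt with rfl | ha'
  · have h := Real.log_le_log hd' (by linarith : d ≤ A + D)
    have := mul_le_mul_of_nonneg_left h hd
    simp only [zero_add, neg_zero, zero_mul]
    linarith
  have hA : 0 < A := by linarith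
  have hD : 0 < D := by linarith
  have hB : 0 < A + D := by linarith
  have hb : 0 < a + d := by linarith
  have h1 := Real.log_le_sub_one_of_pos
    (show 0 < A * (a + d) / (a * (A + D)) by positivity)
  have h2 := Real.log_le_sub_one_of_pos
    (show 0 < D * (a + d) / (d * (A + D)) by positivity)
  rw [Real.log_div (by positivity) (by positivity), Real.log_mul (by positivity) (by positivity),
    Real.log_mul (by positivity) (by positivity)] at h1 h2
  have h3 := mul_le_mul_of_nonneg_left h1 ha
  have h4 := mul_le_mul_of_nonneg_left h2 hd
  have h5 := mul_le_mul_of_nonneg_left (Real.log_le_log hd' hdD) hd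
  have h6 : a * (A * (a + d) / (a * (A + D)) - 1) + d * (D * (a + d) / (d * (A + D)) - 1) = 0 := by
    field_simp
    ring
  linarith

theorem Real.negMulLog_add_le {x y : ℝ} (hx : 0 ≤ x) (hy : 0 ≤ y) :
    Real.negMulLog (x + y) ≤ Real.negMulLog x + Real.negMulLog y := by
  simp only [Real.negMulLog]
  rcases hx.eq_or_lt with rfl | hx'
  · simp
  rcases hy.eq_or_lt with rfl | hy'
  · simp
  have h1 := mul_le_mul_of_nonneg_left (Real.log_le_log hx' (by linarith : x ≤ x + y)) hx
  have h2 := mul_le_mul_of_nonneg_left (Real.log_le_log hy' (by linarith : y ≤ x + y)) hy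
  linarith

theorem Real.negMulLog_le_negMulLog_add {x y : ℝ} (hx : 0 ≤ x) (hxy : x ≤ y) (hy : y ≤ 1) :
    Real.negMulLog x ≤ Real.negMulLog y + y := by
  simp only [Real.negMulLog]
  rcases hx.eq_or_lt with rfl | hx'
  · have := Real.negMulLog_nonneg hxy hy
    simp only [Real.negMulLog] at this
    simp only [neg_zero, zero_mul]
    linarith
  have hy' : 0 < y := by linarith
  have h1 := Real.log_le_sub_one_of_pos (div_pos hy' hx')
  rw [Real.log_div hy'.ne' hx'.ne'] at h1
  have h2 := mul_le_mul_of_nonneg_left h1 hx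
  have h3 : x * (y / x - 1) = y - x := by field_simp
  have h4 := mul_le_mul_of_nonneg_right hxy (neg_nonneg.2 (Real.log_nonpos hy'.le hy))
  linarith

/-- The homogeneous extension of the Shannon entropy is monotone. -/
theorem tsum_negMulLog_sub_mono {a b : ℕ → ℝ} (ha0 : ∀ i, 0 ≤ a i) (hab : ∀ i, a i ≤ b i)
    (hb : Summable b) (hηa : Summable fun i ↦ Real.negMulLog (a i))
    (hηb : Summable fun i ↦ Real.negMulLog (b i)) :
    (∑' i, Real.negMulLog (a i)) - Real.negMulLog (∑' i, a i)
      ≤ (∑' i, Real.negMulLog (b i)) - Real.negMulLog (∑' i, b i) := by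
  have ha : Summable a := Summable.of_nonneg_of_le ha0 hab hb
  have hd : Summable fun i ↦ b i - a i := hb.sub ha
  have key : ∀ i, Real.negMulLog (a i) + a i * Real.log (∑' j, a j)
      ≤ Real.negMulLog (b i) + b i * Real.log (∑' j, b j) := by
    intro i
    have h := Real.negMulLog_add_mul_log_mono (ha0 i) (sub_nonneg.2 (hab i))
      (ha.le_tsum i fun j _ ↦ ha0 j) (hd.le_tsum i fun j _ ↦ sub_nonneg.2 (hab j))
    rwa [hb.tsum_sub ha, add_sub_cancel, add_sub_cancel] at h
  have h := Summable.tsum_le_tsum key (hηa.add (ha.mul_right _)) (hηb.add (hb.mul_right _))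
  rw [hηa.tsum_add (ha.mul_right _), hηb.tsum_add (hb.mul_right _), tsum_mul_right,
    tsum_mul_right] at h
  simp only [Real.negMulLog] at h ⊢
  linarith

theorem gFun_eq_negMulLog (x : ℝ) :
    gFun x = Real.negMulLog x - Real.negMulLog (x + 1) := by
  simp only [gFun, Real.negMulLog]
  ring

theorem gFun_monotoneOn : MonotoneOn gFun (Set.Ici 0) := by
  have hc : Continuous gFun := by
    simp only [funext gFun_eq_negMulLog]
    exact Real.continuous_negMulLog.sub
      (Real.continuous_negMulLog.comp (continuous_id.add continuous_const))
  have hderiv : ∀ x : ℝ, 0 < x → HasDerivAt gFun (Real.log (x + 1) - Real.log x) x := by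
    intro x hx
    have h1 := Real.hasDerivAt_negMulLog hx.ne'
    have h2 := (Real.hasDerivAt_negMulLog (by positivity : x + 1 ≠ 0)).comp_add_const x 1
    have h3 := h1.sub h2
    rw [funext gFun_eq_negMulLog]
    exact h3.congr_deriv (by ring)
  refine monotoneOn_of_deriv_nonneg (convex_Ici 0) hc.continuousOn ?_ ?_
  · intro x hx
    rw [interior_Ici, Set.mem_Ioi] at hx
    exact (hderiv x hx).differentiableAt.differentiableWithinAt
  · intro x hx
    rw [interior_Ici, Set.mem_Ioi] at hx
    rw [(hderiv x hx).deriv, sub_nonneg]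
    exact Real.log_le_log hx (by linarith)

theorem summable_negMulLog_of_shannonEnt_ne_top {p : ℕ → ℝ} (h0 : ∀ i, 0 ≤ p i)
    (h1 : ∀ i, p i ≤ 1) (hfin : shannonEnt p ≠ ∞) :
    Summable fun i ↦ Real.negMulLog (p i) := by
  have h := ENNReal.summable_toReal hfin
  simpa only [ENNReal.toReal_ofReal (Real.negMulLog_nonneg (h0 _) (h1 _))] using h

theorem shannonEnt_eq_ofReal {p : ℕ → ℝ} (h0 : ∀ i, 0 ≤ p i) (h1 : ∀ i, p i ≤ 1)
    (hfin : shannonEnt p ≠ ∞) :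
    shannonEnt p = ENNReal.ofReal (∑' i, Real.negMulLog (p i)) :=
  (ENNReal.ofReal_tsum_of_nonneg (fun i ↦ Real.negMulLog_nonneg (h0 i) (h1 i))
    (summable_negMulLog_of_shannonEnt_ne_top h0 h1 hfin)).symm

/-- if `p̄` is a probability distribution on `ℕ` with finite Shannon
entropy, `ε ∈ (0,1]` and `q̄` is a probability distribution with `TV(p̄,q̄) ≤ ε`, then
`H(q̄) ≥ H(p̄) − H̃(p̄∧ε) − g(ε)`, where
`H̃(p̄∧ε) = ∑ᵢ η(min(pᵢ,ε)) − η(∑ᵢ min(pᵢ,ε))`. -/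
theorem shannonEnt_local_lower_bound_wedge (p q : ℕ → ℝ)
    (hp0 : ∀ i, 0 ≤ p i) (hps : Summable p) (hp1 : ∑' i, p i = 1)
    (hpfin : shannonEnt p ≠ ∞)
    (hq0 : ∀ i, 0 ≤ q i) (hqs : Summable q) (hq1 : ∑' i, q i = 1)
    (ε : ℝ) (hε : ε ∈ Set.Ioc (0 : ℝ) 1)
    (hTV : (1 / 2) * ∑' i, |p i - q i| ≤ ε) :
    ENNReal.ofReal
        ((shannonEnt p).toReal
          - ((∑' i, Real.negMulLog (min (p i) ε))
              - Real.negMulLog (∑' i, min (p i) ε))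
          - gFun ε)
      ≤ shannonEnt q := by
  by_cases hqfin : shannonEnt q = ∞
  · rw [hqfin]
    exact le_top
  have hp_le : ∀ i, p i ≤ 1 := fun i ↦ hp1 ▸ hps.le_tsum i fun j _ ↦ hp0 j
  have hq_le : ∀ i, q i ≤ 1 := fun i ↦ hq1 ▸ hqs.le_tsum i fun j _ ↦ hq0 j
  have hηp := summable_negMulLog_of_shannonEnt_ne_top hp0 hp_le hpfin
  have hηq := summable_negMulLog_of_shannonEnt_ne_top hq0 hq_le hqfin
  have hηp0 : ∀ i, 0 ≤ Real.negMulLog (p i) := fun i ↦ Real.negMulLog_nonneg (hp0 i) (hp_le i)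
  have hηq0 : ∀ i, 0 ≤ Real.negMulLog (q i) := fun i ↦ Real.negMulLog_nonneg (hq0 i) (hq_le i)
  rw [shannonEnt_eq_ofReal hq0 hq_le hqfin, shannonEnt_eq_ofReal hp0 hp_le hpfin,
    ENNReal.toReal_ofReal (tsum_nonneg hηp0)]
  refine ENNReal.ofReal_le_ofReal ?_
  -- `m = max p q = q + a`, where `a = (p - q)₊` has total mass `δ = TV(p, q)`.
  set m : ℕ → ℝ := fun i ↦ max (p i) (q i) with hm
  set a : ℕ → ℝ := fun i ↦ m i - q i with ha
  set c : ℕ → ℝ := fun i ↦ min (p i) ε with hc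
  have hpm : ∀ i, p i ≤ m i := fun i ↦ le_max_left _ _
  have hqm : ∀ i, q i ≤ m i := fun i ↦ le_max_right _ _
  have hm0 : ∀ i, 0 ≤ m i := fun i ↦ (hp0 i).trans (hpm i)
  have hm_le : ∀ i, m i ≤ 1 := fun i ↦ max_le (hp_le i) (hq_le i)
  have hms : Summable m := Summable.of_nonneg_of_le hm0
    (fun i ↦ max_le (by linarith [hq0 i]) (by linarith [hp0 i])) (hps.add hqs)
  have has : Summable a := hms.sub hqs
  have ha0 : ∀ i, 0 ≤ a i := fun i ↦ sub_nonneg.2 (hqm i)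
  have hap : ∀ i, a i ≤ p i := fun i ↦
    sub_le_iff_le_add.2 (max_le (by linarith [hq0 i]) (by linarith [hp0 i]))
  have hcs : Summable c := Summable.of_nonneg_of_le (fun i ↦ le_min (hp0 i) hε.1.le)
    (fun i ↦ min_le_left _ _) hps
  have hδ : ∑' i, a i = (1 / 2) * ∑' i, |p i - q i| := by
    have h : ∀ i, |p i - q i| = 2 * a i - (p i - q i) := by
      intro i
      simp only [ha, hm]
      rcases le_total (p i) (q i) with h | h
      · rw [abs_of_nonpos (by linarith), max_eq_right h]; ring
      · rw [abs_of_nonneg (by linarith), max_eq_left h]; ring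
    rw [tsum_congr h, (has.mul_left 2).tsum_sub (hps.sub hqs), hps.tsum_sub hqs, hp1, hq1,
      tsum_mul_left]
    ring
  have hmsum : ∑' i, m i = (∑' i, a i) + 1 := by
    simp only [ha]
    rw [hms.tsum_sub hqs, hq1]
    ring
  have hδε : ∑' i, a i ≤ ε := hδ ▸ hTV
  have hac : ∀ i, a i ≤ c i := fun i ↦
    le_min (hap i) ((has.le_tsum i fun j _ ↦ ha0 j).trans hδε)
  have hηm : Summable fun i ↦ Real.negMulLog (m i) := by
    refine Summable.of_nonneg_of_le (fun i ↦ Real.negMulLog_nonneg (hm0 i) (hm_le i))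
      (fun i ↦ ?_) (hηp.add hηq)
    simp only [hm]
    rcases max_choice (p i) (q i) with h | h <;> rw [h] <;> linarith [hηp0 i, hηq0 i]
  have hη_of_le : ∀ b : ℕ → ℝ, (∀ i, 0 ≤ b i) → (∀ i, b i ≤ p i) →
      Summable fun i ↦ Real.negMulLog (b i) := fun b hb0 hbp ↦
    Summable.of_nonneg_of_le
      (fun i ↦ Real.negMulLog_nonneg (hb0 i) ((hbp i).trans (hp_le i)))
      (fun i ↦ Real.negMulLog_le_negMulLog_add (hb0 i) (hbp i) (hp_le i)) (hηp.add hps)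
  have hηa := hη_of_le a ha0 hap
  have hηc := hη_of_le c (fun i ↦ (ha0 i).trans (hac i)) fun i ↦ min_le_left _ _
  have h_pm := tsum_negMulLog_sub_mono hp0 hpm hms hηp hηm
  have h_ac := tsum_negMulLog_sub_mono ha0 hac hcs hηa hηc
  have h_mqa : ∑' i, Real.negMulLog (m i)
      ≤ (∑' i, Real.negMulLog (q i)) + ∑' i, Real.negMulLog (a i) := by
    rw [← hηq.tsum_add hηa]
    refine Summable.tsum_le_tsum (fun i ↦ ?_) hηm (hηq.add hηa)
    have h := Real.negMulLog_add_le (hq0 i) (ha0 i)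
    rwa [show q i + a i = m i from add_sub_cancel _ _] at h
  have hg := gFun_monotoneOn (Set.mem_Ici.2 (tsum_nonneg ha0)) (Set.mem_Ici.2 hε.1.le) hδε
  rw [gFun_eq_negMulLog (∑' i, a i)] at hg
  rw [hp1, Real.negMulLog_one, hmsum] at h_pm
  linarith
end

section
/- For any nonnegative real numbers x and y with 0 < x + y ≤ 1 one has (x+y)·h₂(x/(x+y)) ≤ h₂(x). -/
/-- The binary entropy `h₂(x) = η(x) + η(1−x)`, where `η(x) = −x·ln x`. -/
noncomputable def binEnt (x : ℝ) : ℝ := Real.negMulLog x + Real.negMulLog (1 - x)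

theorem binEnt_eq_binEntropy (x : ℝ) : binEnt x = Real.binEntropy x :=
  (Real.binEntropy_eq_negMulLog_add_negMulLog_one_sub x).symm

/-- for nonnegative reals `x, y` with `0 < x + y ≤ 1` one has
`(x+y)·h₂(x/(x+y)) ≤ h₂(x)`. -/
theorem binEnt_scaled_le (x y : ℝ) (hx : 0 ≤ x) (hy : 0 ≤ y)
    (hpos : 0 < x + y) (hle : x + y ≤ 1) :
    (x + y) * binEnt (x / (x + y)) ≤ binEnt x := by
  have hmem : x / (x + y) ∈ Set.Icc (0 : ℝ) 1 :=
    ⟨by positivity, (div_le_one hpos).2 (by linarith)⟩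
  have h := Real.strictConcave_binEntropy.concaveOn.2 hmem (Set.left_mem_Icc.2 zero_le_one)
    hpos.le (sub_nonneg.2 hle) (add_sub_cancel (x + y) 1)
  simpa [binEnt_eq_binEntropy, mul_div_cancel₀ x hpos.ne'] using h
end

section
/- Let p̄ = (p_{ij}) be any joint probability distribution on ℕ×ℕ, let ε ∈ (0,1], and let q̄ = (q_{ij}) be any joint probability distribution on ℕ×ℕ with TV(p̄,q̄) ≤ ε. Then H(X₁|X₂)_q̄ ≥ H̃(X₁|X₂)_{[p̄−ε]₊} − g(ε). -/
open scoped ENNReal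

/-- The conditional entropy (equivocation)
`H(X₁|X₂)_p̄ = ∑_{ij} p_{ij}·ln([p̄₂]_j / p_{ij}) ∈ [0,+∞]` (terms with `p_{ij} = 0`
vanish), where `p̄₂ = (∑ᵢ p_{ij})_j` is the second marginal. -/
noncomputable def condEnt (p : ℕ × ℕ → ℝ) : ℝ≥0∞ :=
  ∑' x : ℕ × ℕ, ENNReal.ofReal (p x * Real.log ((∑' i : ℕ, p (i, x.2)) / p x))

/-- The homogeneous extension `H̃(X₁|X₂)_ā = ‖ā‖₁·H(X₁|X₂)_{ā/‖ā‖₁}`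
(equal to `0` at `ā = 0`). -/
noncomputable def condEntExt (a : ℕ × ℕ → ℝ) : ℝ≥0∞ :=
  ENNReal.ofReal (∑' x, a x) * condEnt (fun x => a x / ∑' y, a y)

/-- The function `(a, A) ↦ a * log (A / a)` increases when `a` and `A - a` increase. -/
lemma mul_log_div_le_mul_log_div {a A b B : ℝ} (ha : 0 ≤ a) (haA : a ≤ A) (hab : a ≤ b)
    (hAB : A - a ≤ B - b) : a * Real.log (A / a) ≤ b * Real.log (B / b) := by
  rcases ha.eq_or_lt with rfl | ha
  · rcases hab.eq_or_lt with rfl | hb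
    · simp
    · rw [zero_mul]
      exact mul_nonneg hb.le (Real.log_nonneg ((one_le_div hb).2 (by linarith)))
  · have hb : 0 < b := ha.trans_le hab
    have hs : 0 ≤ (A - a) / b := div_nonneg (by linarith) hb.le
    have bernoulli : A / a ≤ (1 + (A - a) / b) ^ (b / a) := by
      have h := one_add_mul_self_le_rpow_one_add (s := (A - a) / b) (by linarith)
        ((one_le_div ha).2 hab)
      refine le_trans (le_of_eq ?_) h
      field_simp
      ring
    have hlog : Real.log (A / a) ≤ b / a * Real.log (1 + (A - a) / b) := by
      rw [← Real.log_rpow (by linarith)]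
      exact Real.log_le_log (div_pos (by linarith) ha) bernoulli
    have hmono : Real.log (1 + (A - a) / b) ≤ Real.log (B / b) := by
      apply Real.log_le_log (by linarith)
      rw [one_add_div hb.ne']
      gcongr
      linarith
    calc a * Real.log (A / a) ≤ a * (b / a * Real.log (1 + (A - a) / b)) := by gcongr
      _ = b * Real.log (1 + (A - a) / b) := by field_simp
      _ ≤ b * Real.log (B / b) := by gcongr

/-- Conditional entropy is monotone on summable nonnegative families. -/
lemma condEnt_mono {a b : ℕ × ℕ → ℝ} (ha : ∀ x, 0 ≤ a x) (hab : ∀ x, a x ≤ b x)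
    (hb : Summable b) : condEnt a ≤ condEnt b := by
  have has : Summable a := hb.of_nonneg_of_le ha hab
  refine ENNReal.tsum_le_tsum fun ⟨i, j⟩ => ENNReal.ofReal_le_ofReal ?_
  have hinj : Function.Injective fun i : ℕ => (i, j) := fun _ _ h => (Prod.ext_iff.1 h).1
  have haj : Summable fun i => a (i, j) := has.comp_injective hinj
  have hbj : Summable fun i => b (i, j) := hb.comp_injective hinj
  have hdiff := (hbj.sub haj).le_tsum i fun k _ => sub_nonneg.2 (hab (k, j))
  rw [hbj.tsum_sub haj] at hdiff
  exact mul_log_div_le_mul_log_div (ha _) (haj.le_tsum i fun k _ => ha (k, j)) (hab _)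
    (by linarith)

/-- On nonnegative families the homogeneous extension of `condEnt` is bounded by `condEnt`. -/
lemma condEntExt_le_condEnt {a : ℕ × ℕ → ℝ} (ha : ∀ x, 0 ≤ a x) :
    condEntExt a ≤ condEnt a := by
  unfold condEntExt
  rcases (tsum_nonneg ha).eq_or_lt with h | h
  · rw [← h, ENNReal.ofReal_zero, zero_mul]
    exact zero_le
  · unfold condEnt
    rw [← ENNReal.tsum_mul_left]
    refine ENNReal.tsum_le_tsum fun x => ?_
    rw [← ENNReal.ofReal_mul h.le, tsum_div_const, div_div_div_cancel_right₀ h.ne',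
      ← mul_assoc, mul_div_cancel₀ _ h.ne']

/-- Two summable families with equal sums differ pointwise by at most half their `ℓ¹` distance. -/
lemma sub_le_half_tsum_abs_sub {ι : Type*} {p q : ι → ℝ} (hp : Summable p) (hq : Summable q)
    (h : ∑' x, p x = ∑' x, q x) (x : ι) : p x - q x ≤ (1 / 2) * ∑' x, |p x - q x| := by
  have hd := hp.sub hq
  have hx := (hd.abs.add hd).le_tsum x fun y _ => neg_le_iff_add_nonneg.1 (neg_le_abs (p y - q y))
  rw [hd.abs.tsum_add hd, hp.tsum_sub hq, h, sub_self, add_zero] at hx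
  linarith [le_abs_self (p x - q x)]

/-- for joint probability distributions `p̄, q̄` on `ℕ×ℕ` with
`TV(p̄,q̄) ≤ ε`, `ε ∈ (0,1]`, one has `H(X₁|X₂)_q̄ ≥ H̃(X₁|X₂)_{[p̄−ε]₊} − g(ε)`,
stated in `[0,+∞]` as `H̃(X₁|X₂)_{[p̄−ε]₊} ≤ H(X₁|X₂)_q̄ + g(ε)`. -/
theorem condEnt_local_lower_bound (p q : ℕ × ℕ → ℝ)
    (hp0 : ∀ x, 0 ≤ p x) (hps : Summable p) (hp1 : ∑' x, p x = 1)
    (hq0 : ∀ x, 0 ≤ q x) (hqs : Summable q) (hq1 : ∑' x, q x = 1)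
    (ε : ℝ) (hε : ε ∈ Set.Ioc (0 : ℝ) 1)
    (hTV : (1 / 2) * ∑' x, |p x - q x| ≤ ε) :
    condEntExt (fun x => max (p x - ε) 0) ≤ condEnt q + ENNReal.ofReal (gFun ε) := by
  have ha : ∀ x, 0 ≤ max (p x - ε) 0 := fun x => le_max_right _ _
  have haq : ∀ x, max (p x - ε) 0 ≤ q x := fun x =>
    max_le (by linarith [sub_le_half_tsum_abs_sub hps hqs (hp1.trans hq1.symm) x]) (hq0 x)
  exact (condEntExt_le_condEnt ha).trans ((condEnt_mono ha haq hqs).trans le_self_add)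
end

section
/- For any joint probability distributions p̄ = (p_{ij}) and q̄ = (q_{ij}) on ℕ×ℕ and any λ ∈ [0,1], the conditional entropy satisfies H(X₁|X₂)_{λp̄+(1−λ)q̄} ≤ λ·H(X₁|X₂)_p̄ + (1−λ)·H(X₁|X₂)_q̄ + h₂(λ), where the inequality holds in [0,+∞] (both sides may equal +∞). -/
open scoped ENNReal

lemma add_mul_log_div_add_le {a b R : ℝ} (ha : 0 ≤ a) (hb : 0 ≤ b) (hR : a + b ≤ R) :
    (a + b) * Real.log (R / (a + b)) ≤ a * Real.log (R / a) + b * Real.log (R / b) := by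
  rcases ha.eq_or_lt with rfl | ha
  · simp
  rcases hb.eq_or_lt with rfl | hb
  · simp
  have hR0 : 0 < R := by linarith
  have h1 : Real.log (R / (a + b)) ≤ Real.log (R / a) :=
    Real.log_le_log (by positivity) (by gcongr; linarith)
  have h2 : Real.log (R / (a + b)) ≤ Real.log (R / b) :=
    Real.log_le_log (by positivity) (by gcongr; linarith)
  nlinarith

lemma mul_log_div_add_le {l p P R : ℝ} (hl : 0 < l) (hp : 0 ≤ p) (hP : p ≤ P)
    (hR : l * p ≤ R) :
    l * p * Real.log (R / (l * p)) + l * p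
      ≤ l * (p * Real.log (P / p)) + p * Real.negMulLog l + l * (p / P * R) := by
  rcases hp.eq_or_lt with rfl | hp
  · simp
  have hP0 : 0 < P := hp.trans_le hP
  have hR0 : 0 < R := (mul_pos hl hp).trans_le hR
  have h := Real.log_le_sub_one_of_pos (div_pos hR0 hP0)
  rw [Real.log_div hR0.ne' hP0.ne'] at h
  rw [Real.log_div hR0.ne' (mul_pos hl hp).ne', Real.log_mul hl.ne' hp.ne',
    Real.log_div hP0.ne' hp.ne', Real.negMulLog]
  have h2 := mul_le_mul_of_nonneg_left h (mul_pos hl hp).le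
  have h3 : p / P * R = p * (R / P) := by ring
  rw [h3]
  linarith

lemma summable_prod_left {p : ℕ × ℕ → ℝ} (hps : Summable p) (j : ℕ) :
    Summable fun i => p (i, j) :=
  hps.comp_injective (Prod.mk_left_injective j)

lemma le_marginal {p : ℕ × ℕ → ℝ} (hp0 : ∀ x, 0 ≤ p x) (hps : Summable p) (x : ℕ × ℕ) :
    p x ≤ ∑' i, p (i, x.2) :=
  (summable_prod_left hps x.2).le_tsum x.1 fun _ _ => hp0 _

lemma mul_log_marginal_div_nonneg {p : ℕ × ℕ → ℝ} (hp0 : ∀ x, 0 ≤ p x) (hps : Summable p)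
    (x : ℕ × ℕ) : 0 ≤ p x * Real.log ((∑' i, p (i, x.2)) / p x) := by
  rcases (hp0 x).eq_or_lt with h | h
  · simp [← h]
  · exact mul_nonneg h.le
      (Real.log_nonneg ((one_le_div h).2 (le_marginal hp0 hps x)))

lemma tsum_ofReal_eq_one {p : ℕ × ℕ → ℝ} (hp0 : ∀ x, 0 ≤ p x) (hps : Summable p)
    (hp1 : ∑' x, p x = 1) : ∑' x, ENNReal.ofReal (p x) = 1 := by
  rw [← ENNReal.ofReal_tsum_of_nonneg hp0 hps, hp1, ENNReal.ofReal_one]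

lemma tsum_div_marginal_mul_marginal_le {p r : ℕ × ℕ → ℝ} (hp0 : ∀ x, 0 ≤ p x)
    (hps : Summable p) (hr0 : ∀ x, 0 ≤ r x) (hrs : Summable r) :
    ∑' x : ℕ × ℕ, ENNReal.ofReal (p x / (∑' i, p (i, x.2)) * ∑' i, r (i, x.2))
      ≤ ∑' x, ENNReal.ofReal (r x) := by
  rw [ENNReal.tsum_prod', ENNReal.tsum_prod', ENNReal.tsum_comm,
    ENNReal.tsum_comm (f := fun a b => ENNReal.ofReal (r (a, b)))]
  refine ENNReal.tsum_le_tsum fun j => ?_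
  have hP : 0 ≤ ∑' i, p (i, j) := tsum_nonneg fun _ => hp0 _
  have hR : 0 ≤ ∑' i, r (i, j) := tsum_nonneg fun _ => hr0 _
  rw [← ENNReal.ofReal_tsum_of_nonneg (fun _ => hr0 _) (summable_prod_left hrs j),
    ← ENNReal.ofReal_tsum_of_nonneg
      (fun i => mul_nonneg (div_nonneg (hp0 _) hP) hR)
      (((summable_prod_left hps j).div_const _).mul_right _)]
  refine ENNReal.ofReal_le_ofReal ?_
  rw [tsum_mul_right, tsum_div_const]
  exact mul_le_of_le_one_left hR (div_self_le_one _)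

/-- for joint probability distributions `p̄, q̄` on `ℕ×ℕ` and
`λ ∈ [0,1]`, the conditional entropy satisfies
`H(X₁|X₂)_{λp̄+(1−λ)q̄} ≤ λ·H(X₁|X₂)_p̄ + (1−λ)·H(X₁|X₂)_q̄ + h₂(λ)` in `[0,+∞]`. -/
theorem condEnt_almost_convex (p q : ℕ × ℕ → ℝ)
    (hp0 : ∀ x, 0 ≤ p x) (hps : Summable p) (hp1 : ∑' x, p x = 1)
    (hq0 : ∀ x, 0 ≤ q x) (hqs : Summable q) (hq1 : ∑' x, q x = 1)
    (l : ℝ) (hl : l ∈ Set.Icc (0 : ℝ) 1) :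
    condEnt (fun x => l * p x + (1 - l) * q x)
      ≤ ENNReal.ofReal l * condEnt p + ENNReal.ofReal (1 - l) * condEnt q
        + ENNReal.ofReal (binEnt l) := by
  obtain ⟨hl0, hl1⟩ := hl
  rcases hl0.eq_or_lt with rfl | hl0
  · simp
  rcases hl1.eq_or_lt with rfl | hl1
  · simp
  have hm0 : 0 < 1 - l := sub_pos.2 hl1
  set r : ℕ × ℕ → ℝ := fun x => l * p x + (1 - l) * q x with hr
  have hr0 : ∀ x, 0 ≤ r x := fun x =>
    add_nonneg (mul_nonneg hl0.le (hp0 x)) (mul_nonneg hm0.le (hq0 x))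
  have hrs : Summable r := (hps.mul_left l).add (hqs.mul_left (1 - l))
  have hr1 : ∑' x, r x = 1 := by
    rw [hr, (hps.mul_left l).tsum_add (hqs.mul_left (1 - l)), tsum_mul_left, tsum_mul_left,
      hp1, hq1]
    ring
  have hel : 0 ≤ Real.negMulLog l := Real.negMulLog_nonneg hl0.le hl1.le
  have hem : 0 ≤ Real.negMulLog (1 - l) := Real.negMulLog_nonneg hm0.le (by linarith)
  have pointwise : ∀ x : ℕ × ℕ,
      ENNReal.ofReal (r x * Real.log ((∑' i, r (i, x.2)) / r x)) + ENNReal.ofReal (r x)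
        ≤ (ENNReal.ofReal l * ENNReal.ofReal (p x * Real.log ((∑' i, p (i, x.2)) / p x))
          + ENNReal.ofReal (1 - l)
            * ENNReal.ofReal (q x * Real.log ((∑' i, q (i, x.2)) / q x)))
          + (ENNReal.ofReal (p x) * ENNReal.ofReal (Real.negMulLog l)
            + ENNReal.ofReal (q x) * ENNReal.ofReal (Real.negMulLog (1 - l)))
          + (ENNReal.ofReal l
              * ENNReal.ofReal (p x / (∑' i, p (i, x.2)) * ∑' i, r (i, x.2))
            + ENNReal.ofReal (1 - l)
              * ENNReal.ofReal (q x / (∑' i, q (i, x.2)) * ∑' i, r (i, x.2))) := by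
    intro x
    have hp := mul_log_marginal_div_nonneg hp0 hps x
    have hq := mul_log_marginal_div_nonneg hq0 hqs x
    have hrR := le_marginal hr0 hrs x
    have ha : 0 ≤ l * p x := mul_nonneg hl0.le (hp0 x)
    have hb : 0 ≤ (1 - l) * q x := mul_nonneg hm0.le (hq0 x)
    have hrx : r x = l * p x + (1 - l) * q x := rfl
    have hR : 0 ≤ ∑' i, r (i, x.2) := tsum_nonneg fun _ => hr0 _
    have h1 := add_mul_log_div_add_le ha hb hrR
    have h2 := mul_log_div_add_le (R := ∑' i, r (i, x.2)) hl0 (hp0 x) (le_marginal hp0 hps x)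
      (by linarith)
    have h3 := mul_log_div_add_le (R := ∑' i, r (i, x.2)) hm0 (hq0 x) (le_marginal hq0 hqs x)
      (by linarith)
    have hpP : 0 ≤ p x / (∑' i, p (i, x.2)) * ∑' i, r (i, x.2) :=
      mul_nonneg (div_nonneg (hp0 x) (tsum_nonneg fun _ => hp0 _)) hR
    have hqQ : 0 ≤ q x / (∑' i, q (i, x.2)) * ∑' i, r (i, x.2) :=
      mul_nonneg (div_nonneg (hq0 x) (tsum_nonneg fun _ => hq0 _)) hR
    have hpx := hp0 x
    have hqx := hq0 x
    rw [← ENNReal.ofReal_add (mul_log_marginal_div_nonneg hr0 hrs x) (hr0 x),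
      ← ENNReal.ofReal_mul hl0.le, ← ENNReal.ofReal_mul hm0.le, ← ENNReal.ofReal_mul hpx,
      ← ENNReal.ofReal_mul hqx, ← ENNReal.ofReal_mul hl0.le, ← ENNReal.ofReal_mul hm0.le,
      ← ENNReal.ofReal_add (by positivity) (by positivity),
      ← ENNReal.ofReal_add (by positivity) (by positivity),
      ← ENNReal.ofReal_add (by positivity) (by positivity),
      ← ENNReal.ofReal_add (by positivity) (by positivity),
      ← ENNReal.ofReal_add (by positivity) (by positivity)]
    refine ENNReal.ofReal_le_ofReal ?_
    rw [← hrx] at h1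
    linarith
  have hsum := ENNReal.tsum_le_tsum pointwise
  simp only [ENNReal.tsum_add, ENNReal.tsum_mul_left, ENNReal.tsum_mul_right,
    tsum_ofReal_eq_one hp0 hps hp1, tsum_ofReal_eq_one hq0 hqs hq1,
    tsum_ofReal_eq_one hr0 hrs hr1, one_mul] at hsum
  have hpr := tsum_div_marginal_mul_marginal_le hp0 hps hr0 hrs
  have hqr := tsum_div_marginal_mul_marginal_le hq0 hqs hr0 hrs
  rw [tsum_ofReal_eq_one hr0 hrs hr1] at hpr hqr
  rw [binEnt, ENNReal.ofReal_add hel hem]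
  refine (ENNReal.add_le_add_iff_right ENNReal.one_ne_top).1 (hsum.trans ?_)
  refine add_le_add le_rfl ((add_le_add (mul_le_mul_right hpr _)
    (mul_le_mul_right hqr _)).trans_eq ?_)
  rw [mul_one, mul_one, ← ENNReal.ofReal_add hl0.le hm0.le, add_sub_cancel,
    ENNReal.ofReal_one]
end

section
/- Let p̄ = (p_i) and q̄ = (q_i) be probability distributions on ℕ such that supp p̄ ⊆ supp q̄, let ε ∈ (0,1], and let r̄ = (r_i) be any probability distribution on ℕ with TV(p̄,r̄) ≤ ε. Then D(r̄‖q̄) ≥ ∑_{i ∈ I_ε} (p_i − ε)·ln((p_i − ε)/(c_ε·q_i)) − g(ε) − h̃₂(ε) − h₂(1 − c_ε), where I_ε is the (finite) set of all i with p_i > ε and c_ε = ∑_{i ∈ I_ε} (p_i − ε) (if c_ε = 0 the sum is empty and h₂(1−c_ε) = 0). -/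
open scoped ENNReal
open Classical

/-- The Kullback–Leibler divergence `D(p̄‖q̄) = ∑ᵢ pᵢ·ln(pᵢ/qᵢ) ∈ [0,+∞]`, with the
conventions `0·ln 0 = 0` and `D(p̄‖q̄) = +∞` if `supp p̄ ⊄ supp q̄` (and `+∞` if the
series diverges). -/
noncomputable def klDiv (p q : ℕ → ℝ) : ℝ≥0∞ :=
  if (∀ i, q i = 0 → p i = 0) ∧ Summable (fun i => p i * Real.log (p i / q i)) then
    ENNReal.ofReal (∑' i, p i * Real.log (p i / q i))
  else ∞

/-- `h̃₂(x) = h₂(x)` for `x ∈ [0,1/2]` and `ln 2` for `x ∈ (1/2,1]`. -/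
noncomputable def binEntTil (x : ℝ) : ℝ := if x ≤ 1 / 2 then binEnt x else Real.log 2

lemma gFun_nonneg_s15 {x : ℝ} (h0 : 0 ≤ x) (h1 : x ≤ 1) : 0 ≤ gFun x := by
  have h₁ : 0 ≤ (x + 1) * Real.log (x + 1) :=
    mul_nonneg (by linarith) (Real.log_nonneg (by linarith))
  have h₂ : x * Real.log x ≤ 0 :=
    mul_nonpos_of_nonneg_of_nonpos h0 (Real.log_nonpos h0 h1)
  unfold gFun
  linarith

lemma binEnt_nonneg {x : ℝ} (h0 : 0 ≤ x) (h1 : x ≤ 1) : 0 ≤ binEnt x :=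
  add_nonneg (Real.negMulLog_nonneg h0 h1)
    (Real.negMulLog_nonneg (by linarith) (by linarith))

lemma binEntTil_nonneg {x : ℝ} (h0 : 0 ≤ x) (h1 : x ≤ 1) : 0 ≤ binEntTil x := by
  unfold binEntTil
  split_ifs
  · exact binEnt_nonneg h0 h1
  · exact Real.log_nonneg (by norm_num)

/-- If the total variation distance of two distributions is at most `ε`, then the second one
dominates the first one up to `ε` pointwise. -/
lemma sub_le_of_tv_le {p r : ℕ → ℝ} (hps : Summable p) (hrs : Summable r)
    (hpr : ∑' i, p i = ∑' i, r i) {ε : ℝ} (hTV : (1 / 2) * ∑' i, |p i - r i| ≤ ε) (i : ℕ) :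
    p i - ε ≤ r i := by
  have hd : Summable fun j => p j - r j := hps.sub hrs
  have hsum : ∑' j, (|p j - r j| + (p j - r j)) = ∑' j, |p j - r j| := by
    rw [hd.abs.tsum_add hd, hps.tsum_sub hrs, hpr, sub_self, add_zero]
  have hle := (hd.abs.add hd).le_tsum i fun j _ => by
    have := neg_abs_le (p j - r j)
    linarith
  have habs := le_abs_self (p i - r i)
  rw [hsum] at hle
  linarith

/-- Tangent-line bound for `s ↦ s * log (s / q)`, with contact point `s = d * q`. -/
lemma tangent_le_mul_log_div {s q d : ℝ} (hs : 0 ≤ s) (hq : 0 ≤ q) (hd : 0 ≤ d)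
    (hsq : 0 < s → 0 < q) (hsd : 0 < s → 0 < d) :
    s * Real.log d + s - d * q ≤ s * Real.log (s / q) := by
  rcases hs.eq_or_lt with rfl | hs
  · simp [mul_nonneg hd hq]
  have hq := hsq hs
  have hd := hsd hs
  have hlog := Real.log_le_sub_one_of_pos (show 0 < d * q / s by positivity)
  rw [Real.log_div (by positivity) hs.ne', Real.log_mul hd.ne' hq.ne'] at hlog
  have hmul := mul_le_mul_of_nonneg_left hlog hs.le
  have hcancel : s * (d * q / s - 1) = d * q - s := by field_simp
  rw [Real.log_div hs.ne' hq.ne']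
  linarith

/-- Superadditivity of `x ↦ x * log (x / q)`. -/
lemma add_mul_log_div_le {m s q : ℝ} (hm : 0 ≤ m) (hs : 0 ≤ s) (hq : 0 ≤ q) :
    m * Real.log (m / q) + s * Real.log (s / q) ≤ (m + s) * Real.log ((m + s) / q) := by
  rcases hq.eq_or_lt with rfl | hq
  · simp
  have aux : ∀ x y : ℝ, 0 ≤ x → x ≤ y → x * Real.log (x / q) ≤ x * Real.log (y / q) := by
    intro x y hx hxy
    rcases hx.eq_or_lt with rfl | hx
    · simp
    · gcongr
  have h₁ := aux m (m + s) hm (by linarith)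
  have h₂ := aux s (m + s) hs (by linarith)
  linarith

/-- let `p̄, q̄` be probability distributions on `ℕ` with
`supp p̄ ⊆ supp q̄`, `ε ∈ (0,1]`, and let `r̄` be any probability distribution with
`TV(p̄,r̄) ≤ ε`. Then
`D(r̄‖q̄) ≥ ∑_{i∈I_ε} (pᵢ−ε)·ln((pᵢ−ε)/(c_ε·qᵢ)) − g(ε) − h̃₂(ε) − h₂(1−c_ε)`,
where `I_ε = {i | pᵢ > ε}` and `c_ε = ∑ᵢ max(pᵢ−ε,0)`. -/
theorem klDiv_local_lower_bound (p q r : ℕ → ℝ)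
    (hp0 : ∀ i, 0 ≤ p i) (hps : Summable p) (hp1 : ∑' i, p i = 1)
    (hq0 : ∀ i, 0 ≤ q i) (hqs : Summable q) (hq1 : ∑' i, q i = 1)
    (hsupp : ∀ i, q i = 0 → p i = 0)
    (hr0 : ∀ i, 0 ≤ r i) (hrs : Summable r) (hr1 : ∑' i, r i = 1)
    (ε : ℝ) (hε : ε ∈ Set.Ioc (0 : ℝ) 1)
    (hTV : (1 / 2) * ∑' i, |p i - r i| ≤ ε) :
    ENNReal.ofReal
        ((∑' i, if ε < p i then
            (p i - ε) * Real.log ((p i - ε) / ((∑' k, max (p k - ε) 0) * q i))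
          else 0)
          - gFun ε - binEntTil ε - binEnt (1 - ∑' k, max (p k - ε) 0))
      ≤ klDiv r q := by
  obtain ⟨hε0, hε1⟩ := hε
  unfold klDiv
  split_ifs with hfin
  swap
  · exact le_top
  obtain ⟨hrq, hsum⟩ := hfin
  apply ENNReal.ofReal_le_ofReal
  set m : ℕ → ℝ := fun k => max (p k - ε) 0 with hm
  set c : ℝ := ∑' k, m k with hc
  have hm0 : ∀ i, 0 ≤ m i := fun i => le_max_right _ _
  have hmr : ∀ i, m i ≤ r i := fun i =>
    max_le (sub_le_of_tv_le hps hrs (hp1.trans hr1.symm) hTV i) (hr0 i)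
  have hms : Summable m := hrs.of_nonneg_of_le hm0 hmr
  have hss : Summable fun i => r i - m i := hrs.sub hms
  have hsd : ∑' i, (r i - m i) = 1 - c := by rw [hrs.tsum_sub hms, hr1]
  have hd0 : 0 ≤ 1 - c := hsd ▸ tsum_nonneg fun i => sub_nonneg.2 (hmr i)
  have hpt : ∀ i, (if ε < p i then (p i - ε) * Real.log ((p i - ε) / (c * q i)) else 0)
      = m i * Real.log (m i / q i) - m i * Real.log c := by
    intro i
    split_ifs with hi
    · have hmi : m i = p i - ε := max_eq_left (by linarith)
      have hmpos : 0 < m i := by linarith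
      have hcpos : 0 < c := hmpos.trans_le (hms.le_tsum i fun j _ => hm0 j)
      have hqi : q i ≠ 0 := fun h => by have := hsupp i h; linarith
      rw [← hmi, Real.log_div hmpos.ne' (mul_ne_zero hcpos.ne' hqi),
        Real.log_mul hcpos.ne' hqi, Real.log_div hmpos.ne' hqi]
      ring
    · have hmi : m i = 0 := max_eq_right (by linarith)
      simp [hmi]
  have hmain : ∀ i, (if ε < p i then (p i - ε) * Real.log ((p i - ε) / (c * q i)) else 0)
      + m i * Real.log c + (r i - m i) * Real.log (1 - c) + (r i - m i) - (1 - c) * q i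
      ≤ r i * Real.log (r i / q i) := by
    intro i
    have hadd := add_mul_log_div_le (hm0 i) (sub_nonneg.2 (hmr i)) (hq0 i)
    rw [add_sub_cancel] at hadd
    have htan := tangent_le_mul_log_div (sub_nonneg.2 (hmr i)) (hq0 i) hd0
      (fun h => (hq0 i).lt_of_ne fun h0 => by
        have := hrq i h0.symm
        have := hm0 i
        linarith)
      (fun h => h.trans_le (hsd ▸ hss.le_tsum i fun j _ => sub_nonneg.2 (hmr j)))
    rw [hpt i]
    linarith
  have hfinite : {i | ε < p i}.Finite := by
    have := hps.tendsto_cofinite_zero.eventually (eventually_lt_nhds hε0)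
    refine (Filter.eventually_cofinite.1 this).subset fun i hi => ?_
    exact not_lt.2 (le_of_lt hi)
  have hAs : Summable fun i =>
      if ε < p i then (p i - ε) * Real.log ((p i - ε) / (c * q i)) else 0 :=
    summable_of_hasFiniteSupport (hfinite.subset fun i hi => by
      by_contra h
      exact hi (if_neg h))
  have hlower := ((((hAs.hasSum.add (hms.hasSum.mul_right (Real.log c))).add
    (hss.hasSum.mul_right (Real.log (1 - c)))).add hss.hasSum).sub
    (hqs.hasSum.mul_left (1 - c)))
  have hle := hasSum_le hmain hlower hsum.hasSum
  rw [hsd, hq1, ← hc] at hle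
  have hg := gFun_nonneg_s15 hε0.le hε1
  have hh := binEntTil_nonneg hε0.le hε1
  have hb : binEnt (1 - c) = -(c * Real.log c) - (1 - c) * Real.log (1 - c) := by
    simp only [binEnt, Real.negMulLog, sub_sub_cancel]
    ring
  rw [hb]
  linarith
end

section
/- Let p̄ = (p_i) and q̄ = (q_i) be probability distributions on ℕ such that supp p̄ ⊆ supp q̄ and the Shannon entropy H(p̄) is finite, and let d ≥ 2 be a natural number. Then for every ε ∈ (0, 1 − 1/d] and every probability distribution r̄ = (r_i) on ℕ with at most d nonzero entries and TV(p̄,r̄) ≤ ε one has D(r̄‖q̄) ≥ ∑_{i ∈ I_ε} (−ln q_i)·(p_i − ε) − H(p̄) − ε·ln(d−1) − h₂(ε), where I_ε is the (finite) set of all i with p_i > ε. -/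
open scoped ENNReal
open Classical

/-- A termwise Gibbs inequality. -/
lemma mul_log_add_log_sub_log_le {w p k r : ℝ} (hw : 0 ≤ w) (hwp : w ≤ p) (hwr : w ≤ r)
    (hk : 0 < k) : w * (Real.log p + Real.log k - Real.log r) ≤ p * k - w := by
  rcases hw.eq_or_lt with rfl | hw
  · simpa using mul_nonneg hwp hk.le
  have hp : 0 < p := hw.trans_le hwp
  have hr : 0 < r := hw.trans_le hwr
  rw [← Real.log_mul hp.ne' hk.ne', ← Real.log_div (mul_pos hp hk).ne' hr.ne']
  have h1 := Real.log_le_sub_one_of_pos (div_pos (mul_pos hp hk) hr)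
  have h2 : w * (p * k / r) ≤ p * k := by
    rw [mul_div_assoc', div_le_iff₀ hr, mul_comm]
    exact mul_le_mul_of_nonneg_left hwr (mul_pos hp hk).le
  nlinarith [mul_le_mul_of_nonneg_left h1 hw.le]

/-- One row of a coupling `w` of `p` and `r`: its contribution to the entropy of `r` is bounded
by its contribution to the entropy of `p` plus a conditional cross entropy. -/
lemma sum_mul_neg_log_le {s : Finset ℕ} {p : ℝ} {w r k : ℕ → ℝ} (hw : ∀ j ∈ s, 0 ≤ w j)
    (hwp : ∑ j ∈ s, w j = p) (hwr : ∀ j ∈ s, w j ≤ r j) (hk : ∀ j ∈ s, 0 < k j)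
    (hk1 : ∑ j ∈ s, k j ≤ 1) :
    ∑ j ∈ s, w j * -Real.log (r j) ≤ Real.negMulLog p + ∑ j ∈ s, w j * -Real.log (k j) := by
  have hp : 0 ≤ p := hwp ▸ Finset.sum_nonneg hw
  have h := Finset.sum_le_sum fun j hj => mul_log_add_log_sub_log_le (hw j hj)
    (hwp ▸ Finset.single_le_sum hw hj) (hwr j hj) (hk j hj)
  have h1 : ∑ j ∈ s, w j * (Real.log p + Real.log (k j) - Real.log (r j))
      = p * Real.log p + ∑ j ∈ s, w j * Real.log (k j) - ∑ j ∈ s, w j * Real.log (r j) := by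
    rw [← hwp, Finset.sum_mul, ← Finset.sum_add_distrib, ← Finset.sum_sub_distrib]
    exact Finset.sum_congr rfl fun j _ => by ring
  have h2 : ∑ j ∈ s, (p * k j - w j) ≤ 0 := by
    rw [Finset.sum_sub_distrib, ← Finset.mul_sum, hwp]
    nlinarith
  simp only [mul_neg, Finset.sum_neg_distrib, Real.negMulLog]
  linarith

lemma summable_negMulLog_of_shannonEnt_ne_top_s16 {p : ℕ → ℝ} (hp0 : ∀ i, 0 ≤ p i)
    (hp1 : ∀ i, p i ≤ 1) (hpH : shannonEnt p ≠ ∞) :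
    Summable (fun i => Real.negMulLog (p i)) := by
  refine (ENNReal.summable_toReal hpH).congr fun i => ?_
  exact ENNReal.toReal_ofReal (Real.negMulLog_nonneg (hp0 i) (hp1 i))

lemma toReal_shannonEnt {p : ℕ → ℝ} (hp0 : ∀ i, 0 ≤ p i) (hp1 : ∀ i, p i ≤ 1) :
    (shannonEnt p).toReal = ∑' i, Real.negMulLog (p i) := by
  rw [shannonEnt, ENNReal.tsum_toReal_eq fun i => ENNReal.ofReal_ne_top]
  exact tsum_congr fun i => ENNReal.toReal_ofReal (Real.negMulLog_nonneg (hp0 i) (hp1 i))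

/-- Two distributions at total variation distance at most `ε` share a common part `m` of mass at
least `1 - ε`. -/
lemma exists_common_part {p r : ℕ → ℝ}
    (hp0 : ∀ i, 0 ≤ p i) (hps : Summable p) (hp1 : ∑' i, p i = 1)
    (hr0 : ∀ i, 0 ≤ r i) (hrs : Summable r) (hr1 : ∑' i, r i = 1) {ε : ℝ}
    (hTV : (1 / 2) * ∑' i, |p i - r i| ≤ ε) :
    ∃ (m a b : ℕ → ℝ) (t : ℝ), (∀ i, 0 ≤ m i) ∧ (∀ i, 0 ≤ a i) ∧ (∀ i, 0 ≤ b i) ∧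
      (∀ i, p i = m i + a i) ∧ (∀ i, r i = m i + b i) ∧
      HasSum m (1 - t) ∧ HasSum a t ∧ HasSum b t ∧ t ≤ ε := by
  have hms : Summable fun i => min (p i) (r i) :=
    hps.of_nonneg_of_le (fun i => le_min (hp0 i) (hr0 i)) fun i => min_le_left _ _
  have hP : HasSum p 1 := hp1 ▸ hps.hasSum
  have hR : HasSum r 1 := hr1 ▸ hrs.hasSum
  have ha := hP.sub hms.hasSum
  have hb := hR.sub hms.hasSum
  refine ⟨fun i => min (p i) (r i), fun i => p i - min (p i) (r i), fun i => r i - min (p i) (r i),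
    1 - ∑' i, min (p i) (r i), fun i => le_min (hp0 i) (hr0 i),
    fun i => sub_nonneg.2 (min_le_left _ _), fun i => sub_nonneg.2 (min_le_right _ _),
    fun i => by ring, fun i => by ring, by simpa using hms.hasSum, ha, hb, ?_⟩
  have habs : ∑' i, |p i - r i|
      = (1 - ∑' i, min (p i) (r i)) + (1 - ∑' i, min (p i) (r i)) := by
    rw [← (ha.add hb).tsum_eq]
    refine tsum_congr fun i => ?_
    rcases le_total (p i) (r i) with h | h
    · rw [min_eq_left h, abs_of_nonpos (sub_nonpos.2 h)]; ring
    · rw [min_eq_right h, abs_of_nonneg (sub_nonneg.2 h)]; ring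
  rw [habs] at hTV
  linarith

/-- One-sided continuity bound for the Shannon entropy at a distribution of rank at most `d`. -/
lemma sum_negMulLog_le_of_common_part {p r m a b : ℕ → ℝ} {t ε : ℝ} {d : ℕ} {s : Finset ℕ}
    (hd : 2 ≤ d) (hs : s.card ≤ d) (hrs : ∀ i ∉ s, r i = 0)
    (hε : ε ∈ Set.Ioc (0 : ℝ) (1 - 1 / (d : ℝ)))
    (hm0 : ∀ i, 0 ≤ m i) (ha0 : ∀ i, 0 ≤ a i) (hb0 : ∀ i, 0 ≤ b i)
    (hp : ∀ i, p i = m i + a i) (hr : ∀ i, r i = m i + b i)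
    (hm : HasSum m (1 - t)) (ha : HasSum a t) (hb : HasSum b t) (ht : t ≤ ε)
    (hpH : Summable fun i => Real.negMulLog (p i)) :
    ∑ i ∈ s, Real.negMulLog (r i)
      ≤ (∑' i, Real.negMulLog (p i)) + ε * Real.log ((d : ℝ) - 1) + binEnt ε := by
  obtain ⟨hε0, hε1⟩ := hε
  have hd2 : (2 : ℝ) ≤ d := by exact_mod_cast hd
  have hd1 : (0 : ℝ) < d - 1 := by linarith
  have hsd : (s.card : ℝ) ≤ d := by exact_mod_cast hs
  have hdε : ε * d ≤ d - 1 := by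
    have := mul_le_mul_of_nonneg_right hε1 (by linarith : (0 : ℝ) ≤ d)
    rwa [sub_mul, one_div, inv_mul_cancel₀ (by linarith), one_mul] at this
  have hε' : 0 < 1 - ε := by
    have : 0 < 1 / (d : ℝ) := by positivity
    linarith
  have hκ : 0 < ε / (d - 1) := div_pos hε0 hd1
  have hκd : ε / (d - 1) * d ≤ 1 := by
    rw [div_mul_eq_mul_div, div_le_one hd1]; exact hdε
  have hκ1 : ε / (d - 1) * (d - 1) = ε := div_mul_cancel₀ _ hd1.ne'
  have hκε : ε / (d - 1) ≤ 1 - ε := by linarith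
  have ht0 : 0 ≤ t := ha.nonneg ha0
  have hms : ∀ i ∉ s, m i = 0 := fun i hi => by
    linarith [hrs i hi, hr i, hm0 i, hb0 i]
  have hbs : ∑ j ∈ s, b j = t := by
    refine (hasSum_sum_of_ne_finset_zero fun i hi => ?_).unique hb
    linarith [hrs i hi, hr i, hm0 i, hb0 i]
  have hat : ∀ i, a i * (t / t) = a i := fun i => by
    rcases ht0.eq_or_lt with h | h
    · have : a i ≤ t := le_hasSum ha i fun j _ => ha0 j
      rw [show a i = 0 by linarith [ha0 i], zero_mul]
    · rw [div_self h.ne', mul_one]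
  have hbt : ∀ j, t / t * b j = b j := fun j => by
    rcases ht0.eq_or_lt with h | h
    · have : b j ≤ t := le_hasSum hb j fun j _ => hb0 j
      rw [show b j = 0 by linarith [hb0 j], mul_zero]
    · rw [div_self h.ne', one_mul]
  let w : ℕ → ℕ → ℝ := fun i j => (if i = j then m i else 0) + a i * (b j / t)
  let k : ℕ → ℕ → ℝ := fun i j => if i = j then 1 - ε else ε / (d - 1)
  have hw0 : ∀ i j, 0 ≤ w i j := fun i j => by
    refine add_nonneg ?_ (mul_nonneg (ha0 i) (div_nonneg (hb0 j) ht0))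
    split_ifs
    exacts [hm0 i, le_rfl]
  have hcol : ∀ j, HasSum (fun i => w i j) (r j) := fun j => by
    have h1 : HasSum (fun i => if i = j then m i else 0) (m j) := by
      have := hasSum_ite_eq j (m j)
      refine this.congr_fun fun i => ?_
      by_cases h : i = j <;> simp [h]
    have h2 := h1.add (ha.mul_right (b j / t))
    have h3 : t * (b j / t) = b j := by rw [mul_div_assoc', mul_div_right_comm, hbt]
    rwa [h3, ← hr j] at h2
  have hrow : ∀ i, ∑ j ∈ s, w i j = p i := fun i => by
    rw [Finset.sum_add_distrib, ← Finset.mul_sum, ← Finset.sum_div, hbs, hat, hp i,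
      Finset.sum_ite_eq]
    by_cases h : i ∈ s <;> simp [h, hms]
  have hk0 : ∀ i j, 0 < k i j := fun i j => by
    dsimp only [k]; split_ifs <;> assumption
  have hk1 : ∀ i, ∑ j ∈ s, k i j ≤ 1 := fun i => by
    have h1 : ∑ j ∈ s, k i j
        = ∑ j ∈ s, ((if i = j then 1 - ε - ε / (d - 1) else 0) + ε / (d - 1)) :=
      Finset.sum_congr rfl fun j _ => by dsimp only [k]; split_ifs <;> ring
    have h2 : (s.card : ℝ) * (ε / (d - 1)) ≤ ε / (d - 1) * d := by
      rw [mul_comm]; exact mul_le_mul_of_nonneg_left hsd hκ.le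
    rw [h1, Finset.sum_add_distrib, Finset.sum_ite_eq, Finset.sum_const, nsmul_eq_mul]
    split_ifs <;> linarith
  have hlog : -Real.log (1 - ε) ≤ -Real.log (ε / (d - 1)) :=
    neg_le_neg (Real.log_le_log hκ hκε)
  have hcross : ∀ i, ∑ j ∈ s, w i j * -Real.log (k i j)
      ≤ m i * -Real.log (1 - ε) + a i * -Real.log (ε / (d - 1)) := fun i => by
    have h1 : ∀ j ∈ s, w i j * -Real.log (k i j)
        ≤ (if i = j then m i * -Real.log (1 - ε) else 0)
          + a i * -Real.log (ε / (d - 1)) / t * b j := fun j _ => by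
      have h3 : 0 ≤ a i * (b j / t) := mul_nonneg (ha0 i) (div_nonneg (hb0 j) ht0)
      have h4 : a i * -Real.log (ε / (d - 1)) / t * b j
          = a i * (b j / t) * -Real.log (ε / (d - 1)) := by ring
      rw [h4]
      dsimp only [w, k]
      split_ifs
      · linarith [mul_le_mul_of_nonneg_left hlog h3]
      · linarith
    refine (Finset.sum_le_sum h1).trans_eq ?_
    have h5 : a i * -Real.log (ε / (d - 1)) / t * t = a i * (t / t) * -Real.log (ε / (d - 1)) := by
      ring
    rw [Finset.sum_add_distrib, ← Finset.mul_sum, hbs, Finset.sum_ite_eq, h5, hat]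
    by_cases h : i ∈ s <;> simp [h, hms]
  have hpt : ∀ i, ∑ j ∈ s, w i j * -Real.log (r j) ≤ Real.negMulLog (p i)
      + (m i * -Real.log (1 - ε) + a i * -Real.log (ε / (d - 1))) := fun i =>
    (sum_mul_neg_log_le (fun j _ => hw0 i j) (hrow i)
      (fun j _ => le_hasSum (hcol j) i fun i' _ => hw0 i' j) (fun j _ => hk0 i j) (hk1 i)).trans
      (by linarith [hcross i])
  have hL : HasSum (fun i => ∑ j ∈ s, w i j * -Real.log (r j))
      (∑ j ∈ s, r j * -Real.log (r j)) :=
    hasSum_sum fun j _ => (hcol j).mul_right _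
  have hmain := hasSum_le hpt hL
    (hpH.hasSum.add ((hm.mul_right (-Real.log (1 - ε))).add
      (ha.mul_right (-Real.log (ε / (d - 1))))))
  have hη : ∑ j ∈ s, Real.negMulLog (r j) = ∑ j ∈ s, r j * -Real.log (r j) :=
    Finset.sum_congr rfl fun j _ => by rw [Real.negMulLog]; ring
  have hlin := mul_le_mul_of_nonneg_right ht (sub_nonneg.2 hlog)
  rw [hη]
  rw [Real.log_div hε0.ne' hd1.ne'] at hmain hlin
  have hbin : binEnt ε = ε * -Real.log ε + (1 - ε) * -Real.log (1 - ε) := by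
    simp only [binEnt, Real.negMulLog]
    ring
  rw [hbin]
  linarith

/-- let `p̄, q̄` be probability distributions on `ℕ` with
`supp p̄ ⊆ supp q̄` and `H(p̄) < +∞`, and let `d ≥ 2`. Then for every
`ε ∈ (0, 1−1/d]` and every probability distribution `r̄` with at most `d` nonzero
entries and `TV(p̄,r̄) ≤ ε` one has
`D(r̄‖q̄) ≥ ∑_{i∈I_ε} (−ln qᵢ)·(pᵢ−ε) − H(p̄) − ε·ln(d−1) − h₂(ε)`, where
`I_ε = {i | pᵢ > ε}`. -/
theorem klDiv_local_lower_bound_rank (p q r : ℕ → ℝ)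
    (hp0 : ∀ i, 0 ≤ p i) (hps : Summable p) (hp1 : ∑' i, p i = 1)
    (hq0 : ∀ i, 0 ≤ q i) (hqs : Summable q) (hq1 : ∑' i, q i = 1)
    (hsupp : ∀ i, q i = 0 → p i = 0)
    (hpH : shannonEnt p ≠ ∞)
    (d : ℕ) (hd : 2 ≤ d)
    (hr0 : ∀ i, 0 ≤ r i) (hrs : Summable r) (hr1 : ∑' i, r i = 1)
    (hrank : ∃ s : Finset ℕ, s.card ≤ d ∧ ∀ i ∉ s, r i = 0)
    (ε : ℝ) (hε : ε ∈ Set.Ioc (0 : ℝ) (1 - 1 / (d : ℝ)))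
    (hTV : (1 / 2) * ∑' i, |p i - r i| ≤ ε) :
    ENNReal.ofReal
        ((∑' i, if ε < p i then (-Real.log (q i)) * (p i - ε) else 0)
          - (shannonEnt p).toReal - ε * Real.log ((d : ℝ) - 1) - binEnt ε)
      ≤ klDiv r q := by
  obtain ⟨s, hs, hrs0⟩ := hrank
  rw [klDiv]
  split_ifs with hD
  swap
  · exact le_top
  refine ENNReal.ofReal_le_ofReal ?_
  have hp_le : ∀ i, p i ≤ 1 := fun i => hp1 ▸ hps.le_tsum i fun j _ => hp0 j
  have hq_le : ∀ i, q i ≤ 1 := fun i => hq1 ▸ hqs.le_tsum i fun j _ => hq0 j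
  obtain ⟨m, a, b, t, hm0, ha0, hb0, hp, hr, hm, ha, hb, ht⟩ :=
    exists_common_part hp0 hps hp1 hr0 hrs hr1 hTV
  have hent := sum_negMulLog_le_of_common_part hd hs hrs0 hε hm0 ha0 hb0 hp hr hm ha hb ht
    (summable_negMulLog_of_shannonEnt_ne_top_s16 hp0 hp_le hpH)
  have hpr : ∀ i, p i - ε ≤ r i := fun i => by
    have : a i ≤ t := le_hasSum ha i fun j _ => ha0 j
    linarith [hp i, hr i, hb0 i]
  rw [toReal_shannonEnt hp0 hp_le,
    tsum_eq_sum (s := s) fun i hi => if_neg (by linarith [hpr i, hrs0 i hi]),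
    tsum_eq_sum (f := fun i => r i * Real.log (r i / q i)) (s := s)
      fun i hi => by rw [hrs0 i hi, zero_mul]]
  have hcross : ∑ i ∈ s, (if ε < p i then (-Real.log (q i)) * (p i - ε) else 0)
      ≤ ∑ i ∈ s, (r i * Real.log (r i / q i) + Real.negMulLog (r i)) := by
    refine Finset.sum_le_sum fun i _ => ?_
    have hlq : 0 ≤ -Real.log (q i) := neg_nonneg.2 (Real.log_nonpos (hq0 i) (hq_le i))
    have hterm : r i * Real.log (r i / q i) + Real.negMulLog (r i) = -Real.log (q i) * r i := by
      rcases eq_or_ne (r i) 0 with h | h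
      · simp [h]
      · rw [Real.log_div h fun h0 => h (hD.1 i h0), Real.negMulLog]
        ring
    rw [hterm]
    split_ifs
    · exact mul_le_mul_of_nonneg_left (hpr i) hlq
    · exact mul_nonneg hlq (hr0 i)
  rw [Finset.sum_add_distrib] at hcross
  linarith
end

section
/- Let p̄ = (p_i) and q̄ = (q_i) be probability distributions on ℕ. For ε ∈ (0,1] let I_ε = {i : p_i > ε}, c_ε = ∑_{i ∈ I_ε}(p_i − ε), and for c_ε > 0 let D̃_ε = c_ε·D(c_ε⁻¹[p̄−ε]₊ ‖ q̄) be the homogeneous extension of the Kullback–Leibler divergence at the family [p̄−ε]₊ = (max(p_i−ε,0)). Then D̃_ε tends to D(p̄‖q̄) ≤ +∞ as ε → 0⁺ (convergence in [0,+∞]; if D(p̄‖q̄) = +∞ this means D̃_ε → +∞). -/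
open scoped ENNReal
open Classical

open InformationTheory in
theorem mul_klFun_div {r q : ℝ} (h : q = 0 → r = 0) :
    q * klFun (r / q) = r * Real.log (r / q) + (q - r) := by
  rcases eq_or_ne q 0 with hq | hq
  · simp [hq, h hq]
  · rw [klFun]
    field_simp
    ring

open InformationTheory in
theorem mul_klFun_div_nonneg {r q : ℝ} (hr : 0 ≤ r) (hq : 0 ≤ q) : 0 ≤ q * klFun (r / q) :=
  mul_nonneg hq (klFun_nonneg (div_nonneg hr hq))

open InformationTheory in
theorem mul_klFun_div_le {r p q : ℝ} (hr : 0 ≤ r) (hq : 0 ≤ q) (hrp : r ≤ 2 * p) :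
    q * klFun (r / q) ≤ q + 2 * (q * klFun (p / q)) + 2 * Real.log 2 * p := by
  have hp : 0 ≤ p := by linarith
  have hlog : 0 ≤ Real.log 2 := Real.log_nonneg (by norm_num)
  have hp_kl := mul_klFun_div_nonneg hp hq
  rcases hq.eq_or_lt with rfl | hq'
  · simpa using by positivity
  have hmax : klFun (r / q) ≤ max (klFun 0) (klFun (2 * p / q)) :=
    convexOn_klFun.le_max_of_mem_Icc (Set.mem_Ici.2 le_rfl) (Set.mem_Ici.2 (by positivity))
      ⟨by positivity, by gcongr⟩
  have htwo : q * klFun (2 * p / q) ≤ 2 * (q * klFun (p / q)) + 2 * Real.log 2 * p := by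
    rw [mul_klFun_div (fun h => absurd h hq'.ne'), mul_klFun_div (fun h => absurd h hq'.ne')]
    rcases hp.eq_or_lt with rfl | hp'
    · simp; linarith
    · rw [mul_div_assoc, Real.log_mul two_ne_zero (by positivity)]
      nlinarith
  rw [klFun_zero] at hmax
  rcases le_max_iff.1 hmax with h | h
  · nlinarith [mul_nonneg hlog hp]
  · nlinarith

open InformationTheory (klFun) in
/-- For probability distributions the divergence is a series of nonnegative terms. -/
theorem klDiv_eq_tsum_ofReal {r q : ℕ → ℝ} (hr0 : ∀ i, 0 ≤ r i) (hr : HasSum r 1)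
    (hq0 : ∀ i, 0 ≤ q i) (hq : HasSum q 1) (hac : ∀ i, q i = 0 → r i = 0) :
    klDiv r q = ∑' i, ENNReal.ofReal (q i * klFun (r i / q i)) := by
  have hnn i := mul_klFun_div_nonneg (hr0 i) (hq0 i)
  have hdiff : HasSum (fun i => q i - r i) 0 := by simpa using hq.sub hr
  have hfun : (fun i => q i * klFun (r i / q i)) =
      fun i => r i * Real.log (r i / q i) + (q i - r i) :=
    funext fun i => mul_klFun_div (hac i)
  have hiff : Summable (fun i => q i * klFun (r i / q i)) ↔
      Summable (fun i => r i * Real.log (r i / q i)) := by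
    rw [hfun]
    exact ⟨fun h => by simpa using h.sub hdiff.summable, fun h => h.add hdiff.summable⟩
  by_cases hs : Summable (fun i => r i * Real.log (r i / q i))
  · rw [klDiv, if_pos ⟨hac, hs⟩, ← ENNReal.ofReal_tsum_of_nonneg hnn (hiff.2 hs), hfun,
      hs.tsum_add hdiff.summable, hdiff.tsum_eq, add_zero]
  · rw [klDiv, if_neg (fun h => hs h.2)]
    by_contra hne
    refine hs (hiff.1 ?_)
    simpa [ENNReal.toReal_ofReal (hnn _)] using ENNReal.summable_toReal (Ne.symm hne)

open Filter Topology in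
theorem ENNReal.tendsto_tsum_ofReal_of_dominated {α : Type*} {l : Filter α}
    {f : α → ℕ → ℝ} {g : ℕ → ℝ} {bound : ℕ → ℝ} (hg : ∀ i, 0 ≤ g i)
    (hf : ∀ᶠ x in l, ∀ i, 0 ≤ f x i) (hlim : ∀ i, Tendsto (fun x => f x i) l (𝓝 (g i)))
    (hbound : Summable g → Summable bound) (hle : ∀ᶠ x in l, ∀ i, f x i ≤ bound i) :
    Tendsto (fun x => ∑' i, ENNReal.ofReal (f x i)) l (𝓝 (∑' i, ENNReal.ofReal (g i))) := by
  by_cases hs : Summable g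
  · have hreal : Tendsto (fun x => ∑' i, f x i) l (𝓝 (∑' i, g i)) := by
      refine tendsto_tsum_of_dominated_convergence (hbound hs) hlim ?_
      filter_upwards [hf, hle] with x hx hx' i
      rw [Real.norm_of_nonneg (hx i)]
      exact hx' i
    rw [← ENNReal.ofReal_tsum_of_nonneg hg hs]
    refine (ENNReal.tendsto_ofReal hreal).congr' ?_
    filter_upwards [hf, hle] with x hx hx'
    exact ENNReal.ofReal_tsum_of_nonneg hx (Summable.of_nonneg_of_le hx hx' (hbound hs))
  · have htop : ∑' i, ENNReal.ofReal (g i) = ∞ := by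
      by_contra hne
      refine hs ?_
      simpa [ENNReal.toReal_ofReal (hg _)] using ENNReal.summable_toReal hne
    rw [htop, ENNReal.tendsto_nhds_top_iff_nnreal]
    intro M
    have hM : (M : ℝ≥0∞) < ∑' i, ENNReal.ofReal (g i) := htop ▸ ENNReal.coe_lt_top
    rw [ENNReal.tsum_eq_iSup_sum, lt_iSup_iff] at hM
    obtain ⟨s, hs⟩ := hM
    have hsum : Tendsto (fun x => ∑ i ∈ s, ENNReal.ofReal (f x i)) l
        (𝓝 (∑ i ∈ s, ENNReal.ofReal (g i))) :=
      tendsto_finsetSum s fun i _ => ENNReal.tendsto_ofReal (hlim i)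
    filter_upwards [hsum.eventually_const_lt hs] with x hx
    exact hx.trans_le (ENNReal.sum_le_tsum s)

open Filter Topology in
theorem tendsto_max_sub_zero {x : ℝ} (hx : 0 ≤ x) :
    Tendsto (fun ε : ℝ => max (x - ε) 0) (𝓝[>] 0) (𝓝 x) := by
  have hcont : Continuous (fun ε : ℝ => max (x - ε) 0) := by fun_prop
  simpa [hx] using (hcont.tendsto 0).mono_left nhdsWithin_le_nhds

theorem max_sub_zero_le {x ε : ℝ} (hx : 0 ≤ x) (hε : 0 ≤ ε) : max (x - ε) 0 ≤ x :=
  max_le (by linarith) hx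

theorem summable_max_sub_zero {p : ℕ → ℝ} (hp0 : ∀ i, 0 ≤ p i) (hps : Summable p) {ε : ℝ}
    (hε : 0 ≤ ε) : Summable (fun k => max (p k - ε) 0) :=
  Summable.of_nonneg_of_le (fun _ => le_max_right _ _) (fun k => max_sub_zero_le (hp0 k) hε) hps

open Filter Topology in
theorem tendsto_tsum_max_sub_zero {p : ℕ → ℝ} (hp0 : ∀ i, 0 ≤ p i) (hps : Summable p) :
    Tendsto (fun ε : ℝ => ∑' k, max (p k - ε) 0) (𝓝[>] 0) (𝓝 (∑' k, p k)) := by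
  refine tendsto_tsum_of_dominated_convergence hps (fun k => tendsto_max_sub_zero (hp0 k)) ?_
  filter_upwards [self_mem_nhdsWithin] with ε hε k
  rw [Real.norm_of_nonneg (le_max_right _ _)]
  exact max_sub_zero_le (hp0 k) (le_of_lt hε)

/-- for probability distributions `p̄, q̄` on `ℕ`, the homogeneous
extension `D̃_ε = c_ε·D(c_ε⁻¹·[p̄−ε]₊ ‖ q̄)` (with `c_ε = ∑ᵢ max(pᵢ−ε,0)`) tends to
`D(p̄‖q̄) ≤ +∞` as `ε → 0⁺`, convergence being in `[0,+∞]`. -/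
theorem klDiv_truncated_tendsto (p q : ℕ → ℝ)
    (hp0 : ∀ i, 0 ≤ p i) (hps : Summable p) (hp1 : ∑' i, p i = 1)
    (hq0 : ∀ i, 0 ≤ q i) (hqs : Summable q) (hq1 : ∑' i, q i = 1) :
    Filter.Tendsto
      (fun ε : ℝ =>
        ENNReal.ofReal (∑' k, max (p k - ε) 0) *
          klDiv (fun i => max (p i - ε) 0 / ∑' k, max (p k - ε) 0) q)
      (nhdsWithin 0 (Set.Ioi 0))
      (nhds (klDiv p q)) := by
  set c : ℝ → ℝ := fun ε => ∑' k, max (p k - ε) 0 with hc_def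
  have hc : Filter.Tendsto c (nhdsWithin 0 (Set.Ioi 0)) (nhds 1) :=
    hp1 ▸ tendsto_tsum_max_sub_zero hp0 hps
  have hc_half : ∀ᶠ ε in nhdsWithin (0 : ℝ) (Set.Ioi 0), 1 / 2 < c ε :=
    hc.eventually_const_lt (by norm_num)
  by_cases hac : ∀ i, q i = 0 → p i = 0
  · have hp : HasSum p 1 := hp1 ▸ hps.hasSum
    have hq : HasSum q 1 := hq1 ▸ hqs.hasSum
    have hcoef : Filter.Tendsto (fun ε => ENNReal.ofReal (c ε)) (nhdsWithin 0 (Set.Ioi 0))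
        (nhds 1) := by
      simpa using ENNReal.tendsto_ofReal hc
    have hlim : Filter.Tendsto
        (fun ε => ∑' i, ENNReal.ofReal
          (q i * InformationTheory.klFun (max (p i - ε) 0 / c ε / q i)))
        (nhdsWithin 0 (Set.Ioi 0)) (nhds (klDiv p q)) := by
      rw [klDiv_eq_tsum_ofReal hp0 hp hq0 hq hac]
      refine ENNReal.tendsto_tsum_ofReal_of_dominated
        (bound := fun i => q i + 2 * (q i * InformationTheory.klFun (p i / q i))
          + 2 * Real.log 2 * p i)
        (fun i => mul_klFun_div_nonneg (hp0 i) (hq0 i)) ?_ (fun i => ?_)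
        (fun h => (hqs.add (h.mul_left 2)).add (hps.mul_left _)) ?_
      · filter_upwards [hc_half] with ε hε i
        exact mul_klFun_div_nonneg (div_nonneg (le_max_right _ _) (by linarith)) (hq0 i)
      · have hratio := ((tendsto_max_sub_zero (hp0 i)).div hc one_ne_zero).div_const (q i)
        rw [div_one] at hratio
        exact ((InformationTheory.continuous_klFun.tendsto _).comp hratio).const_mul (q i)
      · filter_upwards [hc_half, self_mem_nhdsWithin] with ε hε hε0 i
        refine mul_klFun_div_le (div_nonneg (le_max_right _ _) (by linarith)) (hq0 i) ?_
        rw [div_le_iff₀ (by linarith)]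
        nlinarith [max_sub_zero_le (hp0 i) (le_of_lt hε0), hp0 i]
    have hprod := ENNReal.Tendsto.mul hcoef (.inl one_ne_zero) hlim (.inr ENNReal.one_ne_top)
    rw [one_mul] at hprod
    refine hprod.congr' ?_
    filter_upwards [hc_half, self_mem_nhdsWithin] with ε hε hε0
    have hε0' : 0 < ε := hε0
    have hcε : 0 < c ε := by linarith
    congr 1
    refine (klDiv_eq_tsum_ofReal (fun i => div_nonneg (le_max_right _ _) hcε.le) ?_ hq0 hq
      fun i hi => ?_).symm
    · have hsum := (summable_max_sub_zero hp0 hps hε0'.le).hasSum.div_const (c ε)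
      rwa [div_self hcε.ne'] at hsum
    · simp [hac i hi, hε0'.le]
  · have htop : klDiv p q = ∞ := if_neg fun h => hac h.1
    push Not at hac
    obtain ⟨i, hqi, hpi⟩ := hac
    have hpi_pos : 0 < p i := (hp0 i).lt_of_ne' hpi
    rw [htop]
    refine tendsto_const_nhds.congr' ?_
    filter_upwards [hc_half, (tendsto_max_sub_zero (hp0 i)).eventually_const_lt hpi_pos]
      with ε hε hmax
    have hcε : 0 < c ε := by linarith
    rw [klDiv, if_neg fun h => (div_pos hmax hcε).ne' (h.1 i hqi),
      ENNReal.mul_top (ENNReal.ofReal_pos.2 hcε).ne']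
end
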